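/- arXiv:2006.14542 — 5 statements merged into one kernel-verified Lean document; each statement's English description precedes it below -/
import Mathlib

section
/- Let n ≥ 1 and k ≥ 1 be integers, Q = [0,1]ⁿ, and let h, g : ℝⁿ → ℝ be positive C^k functions such that h(x) = g(x) for all x ∈ ∂Q and ∫_Q h dx = ∫_Q g dx. Then there exists a C^k diffeomorphism u : ℝⁿ → ℝⁿ such that g(u(x)) · det(Du(x)) = h(x) for all x ∈ Q and u(x) = x for all x ∈ ∂Q. -/
open Set MeasureTheory

theorem contDiff_intervalIntegral_param {P : Type*} [NormedAddCommGroup P] [NormedSpace ℝ P]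
    {k : ℕ∞} {G : P × ℝ → ℝ} (hG : ContDiff ℝ k G) :
    ContDiff ℝ k fun p => ∫ t in (0 : ℝ)..1, G (p, t) := by
  let χ : ContDiffBump (0 : ℝ) := ⟨1, 2, one_pos, one_lt_two⟩
  have key := contDiffOn_convolution_right_with_param_comp (μ := volume) (n := k)
    (ContinuousLinearMap.mul ℝ ℝ) (s := (univ : Set P)) (v := fun _ => (0 : ℝ))
    contDiffOn_const (f := (Ioc (0 : ℝ) 1).indicator fun _ => (1 : ℝ))
    (g := fun p y => χ y * G (p, -y)) (k := Metric.closedBall 0 2) isOpen_univ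
    (isCompact_closedBall _ _)
    (fun p y _ hy => by
      rw [χ.zero_of_le_dist (not_le.1 (mt Metric.mem_closedBall.2 hy)).le, zero_mul])
    ((integrable_indicator_iff measurableSet_Ioc).2
      (integrableOn_const measure_Ioc_lt_top.ne)).locallyIntegrable
    ((χ.contDiff.comp contDiff_snd).mul
      (hG.comp (contDiff_fst.prodMk contDiff_snd.neg))).contDiffOn
  convert contDiffOn_univ.1 key using 1
  funext p
  rw [convolution_def, intervalIntegral.integral_of_le zero_le_one, ← integral_indicator
    measurableSet_Ioc]
  congr 1
  ext t
  by_cases ht : t ∈ Ioc (0 : ℝ) 1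
  · have : χ (-t) = 1 := χ.one_of_mem_closedBall
      (by simpa [χ, abs_le] using ⟨by linarith [ht.1], ht.2⟩)
    simp [ht, this]
  · simp [ht]

section Transport

variable {ι : Type*} [Fintype ι]

/-- `Transports k h g` says that some `C^k` diffeomorphism, fixing the boundary of the unit cube
pointwise and mapping the cube to itself, pulls the density `g` back to `h`. -/
def Transports (k : ℕ∞) (h g : (ι → ℝ) → ℝ) : Prop :=
  ∃ u : (ι → ℝ) → ι → ℝ, ContDiff ℝ k u ∧
    (∃ w, ContDiff ℝ k w ∧ Function.LeftInverse w u ∧ Function.RightInverse w u) ∧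
    MapsTo u (Icc 0 1) (Icc 0 1) ∧
    (∀ x, g (u x) * (fderiv ℝ u x).det = h x) ∧
    ∀ x ∈ frontier (Icc (0 : ι → ℝ) 1), u x = x

namespace Transports

theorem refl (k : ℕ∞) (h : (ι → ℝ) → ℝ) : Transports k h h :=
  ⟨id, contDiff_id, ⟨id, contDiff_id, fun _ => rfl, fun _ => rfl⟩, mapsTo_id _,
    fun x => by simp [fderiv_id, ContinuousLinearMap.det], fun _ _ => rfl⟩

theorem trans {k : ℕ∞} (hk : 1 ≤ k) {a b c : (ι → ℝ) → ℝ} (hab : Transports k a b)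
    (hbc : Transports k b c) : Transports k a c := by
  have hk' : (k : WithTop ℕ∞) ≠ 0 := by
    simpa using (zero_lt_one.trans_le hk).ne'
  obtain ⟨u, hu, ⟨w, hw, hwu, huw⟩, huQ, hdu, hub⟩ := hab
  obtain ⟨v, hv, ⟨z, hz, hzv, hvz⟩, hvQ, hdv, hvb⟩ := hbc
  refine ⟨v ∘ u, hv.comp hu, ⟨w ∘ z, hw.comp hz, hzv.comp hwu, hvz.comp huw⟩, hvQ.comp huQ,
    fun x => ?_, fun x hx => by rw [Function.comp_apply, hub x hx, hvb x hx]⟩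
  rw [fderiv_comp x (hv.differentiable hk' _) (hu.differentiable hk' _), ← hdu x, ← hdv (u x),
    Function.comp_apply, mul_assoc]
  congr 1
  exact LinearMap.det_comp _ _

theorem of_const_mul {k : ℕ∞} {a b : (ι → ℝ) → ℝ} {c : ℝ} (hc : c ≠ 0)
    (h : Transports k (fun x => c * a x) fun x => c * b x) : Transports k a b := by
  obtain ⟨u, hu, hw, huQ, hdu, hub⟩ := h
  refine ⟨u, hu, hw, huQ, fun x => mul_left_cancel₀ hc ?_, hub⟩
  simpa only [mul_assoc] using hdu x

end Transports

theorem mem_frontier_unitCube {x : ι → ℝ} :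
    x ∈ frontier (Icc (0 : ι → ℝ) 1) ↔ x ∈ Icc (0 : ι → ℝ) 1 ∧ ∃ j, x j = 0 ∨ x j = 1 := by
  rw [isClosed_Icc.frontier_eq, mem_sdiff, ← pi_univ_Icc, interior_pi_set finite_univ]
  refine and_congr_right fun hx => ?_
  simp only [mem_univ_pi, Pi.zero_apply, Pi.one_apply, mem_Icc, interior_Icc, mem_Ioo,
    not_forall] at hx ⊢
  refine exists_congr fun j => ?_
  have := hx j
  rw [not_and_or, not_lt, not_lt]
  exact or_congr ⟨fun h => le_antisymm h this.1, fun h => h.le⟩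
    ⟨fun h => le_antisymm this.2 h, fun h => h.ge⟩

theorem volume_restrict_unitCube :
    (volume : Measure (ι → ℝ)).restrict (Icc 0 1) =
      Measure.pi fun _ => volume.restrict (Icc (0 : ℝ) 1) := by
  rw [← pi_univ_Icc, volume_pi, Measure.restrict_pi_pi]
  rfl

end Transport

section Coordinate

variable {ι : Type*} [DecidableEq ι]

theorem update_eq_add_smul (x : ι → ℝ) (i : ι) (s : ℝ) :
    Function.update x i s = x + (s - x i) • Pi.single i 1 := by
  ext j
  rcases eq_or_ne j i with rfl | hj <;> simp [*]

theorem ContDiff.update [Fintype ι] {P : Type*} [NormedAddCommGroup P] [NormedSpace ℝ P] {k : WithTop ℕ∞}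
    {f : P → ι → ℝ} {φ : P → ℝ} (hf : ContDiff ℝ k f) (i : ι) (hφ : ContDiff ℝ k φ) :
    ContDiff ℝ k fun p => Function.update (f p) i (φ p) := by
  simp only [update_eq_add_smul]
  exact hf.add ((hφ.sub (contDiff_pi.1 hf i)).smul contDiff_const)

theorem continuous_comp_update {a : (ι → ℝ) → ℝ} (ha : Continuous a) (x : ι → ℝ) (i : ι) :
    Continuous fun s => a (Function.update x i s) :=
  ha.comp (continuous_const.update i continuous_id)

/-- The primitive of `a` in the direction `i` which vanishes on `x i = 0`. -/
noncomputable def linePrimitive (i : ι) (a : (ι → ℝ) → ℝ) (x : ι → ℝ) : ℝ :=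
  ∫ s in (0 : ℝ)..x i, a (Function.update x i s)

/-- The map replacing the coordinate `x i` by the primitive of `a` in the direction `i`. -/
noncomputable def straighten (i : ι) (a : (ι → ℝ) → ℝ) (x : ι → ℝ) : ι → ℝ :=
  Function.update x i (linePrimitive i a x)

theorem linePrimitive_update (i : ι) (a : (ι → ℝ) → ℝ) (x : ι → ℝ) (s : ℝ) :
    linePrimitive i a (Function.update x i s) =
      ∫ r in (0 : ℝ)..s, a (Function.update x i r) := by
  simp [linePrimitive]

theorem mul_sub_le_linePrimitive_update_sub {i : ι} {a : (ι → ℝ) → ℝ} {c : ℝ}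
    (ha : Continuous a) (hac : ∀ x, c ≤ a x) (x : ι → ℝ) {r s : ℝ} (hrs : r ≤ s) :
    c * (s - r) ≤ linePrimitive i a (Function.update x i s)
      - linePrimitive i a (Function.update x i r) := by
  have hl := continuous_comp_update ha x i
  rw [linePrimitive_update, linePrimitive_update, intervalIntegral.integral_interval_sub_left
    (hl.intervalIntegrable _ _) (hl.intervalIntegrable _ _)]
  have := intervalIntegral.integral_mono_on (μ := volume) hrs
    (continuous_const (y := c) |>.intervalIntegrable _ _)
    (hl.intervalIntegrable _ _) fun t _ => hac (Function.update x i t)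
  simpa [mul_comm] using this

theorem strictMono_linePrimitive_update {i : ι} {a : (ι → ℝ) → ℝ} {c : ℝ} (hc : 0 < c)
    (ha : Continuous a) (hac : ∀ x, c ≤ a x) (x : ι → ℝ) :
    StrictMono fun s => linePrimitive i a (Function.update x i s) := fun r s hrs => by
  have := mul_sub_le_linePrimitive_update_sub (i := i) ha hac x hrs.le
  have := mul_pos hc (sub_pos.2 hrs)
  dsimp only
  linarith

theorem hasDerivAt_linePrimitive_update {i : ι} {a : (ι → ℝ) → ℝ}
    (ha : Continuous a) (x : ι → ℝ) (s : ℝ) :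
    HasDerivAt (fun s => linePrimitive i a (Function.update x i s))
      (a (Function.update x i s)) s := by
  simp only [linePrimitive_update]
  exact ((continuous_comp_update ha x i).integral_hasStrictDerivAt 0 s).hasDerivAt

theorem surjective_linePrimitive_update {i : ι} {a : (ι → ℝ) → ℝ} {c : ℝ} (hc : 0 < c)
    (ha : Continuous a) (hac : ∀ x, c ≤ a x) (x : ι → ℝ) :
    Function.Surjective fun s => linePrimitive i a (Function.update x i s) := by
  have h0 : linePrimitive i a (Function.update x i 0) = 0 := by simp [linePrimitive]
  refine Continuous.surjective (continuous_iff_continuousAt.2 fun s =>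
    (hasDerivAt_linePrimitive_update ha x s).continuousAt) ?_ ?_
  · refine Filter.tendsto_atTop_mono' _ ?_ (Filter.tendsto_id.const_mul_atTop hc)
    filter_upwards [Filter.eventually_ge_atTop 0] with s hs
    simpa [h0] using mul_sub_le_linePrimitive_update_sub (i := i) ha hac x hs
  · refine Filter.tendsto_atBot_mono' _ ?_ (Filter.tendsto_id.const_mul_atBot hc)
    filter_upwards [Filter.eventually_le_atBot 0] with s hs
    have := mul_sub_le_linePrimitive_update_sub (i := i) ha hac x hs
    simp only [id]
    linarith

theorem bijective_straighten {i : ι} {a : (ι → ℝ) → ℝ} {c : ℝ} (hc : 0 < c)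
    (ha : Continuous a) (hac : ∀ x, c ≤ a x) : Function.Bijective (straighten i a) := by
  constructor
  · intro x y hxy
    have hy : y = Function.update x i (y i) := by
      ext j
      rcases eq_or_ne j i with rfl | hj
      · simp
      · simpa [straighten, hj] using (congrFun hxy j).symm
    have hi : linePrimitive i a x = linePrimitive i a y := by
      simpa [straighten] using congrFun hxy i
    rw [← Function.update_eq_self i x, hy] at hi
    have := (strictMono_linePrimitive_update hc ha hac x).injective hi
    rw [hy, ← this, Function.update_eq_self]
  · intro y
    obtain ⟨s, hs⟩ := surjective_linePrimitive_update (i := i) hc ha hac y (y i)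
    exact ⟨Function.update y i s, by simp only at hs; simp [straighten, hs]⟩

theorem update_mem_unitCube {x : ι → ℝ} (hx : x ∈ Icc (0 : ι → ℝ) 1) (i : ι) {s : ℝ}
    (hs : s ∈ Icc (0 : ℝ) 1) : Function.update x i s ∈ Icc (0 : ι → ℝ) 1 :=
  ⟨le_update_iff.2 ⟨hs.1, fun j _ => hx.1 j⟩, update_le_iff.2 ⟨hs.2, fun j _ => hx.2 j⟩⟩

/-- The average of `φ` over the unit segment through `x` in the direction `i`. -/
noncomputable def lineAverage (i : ι) (φ : (ι → ℝ) → ℝ) (x : ι → ℝ) : ℝ :=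
  ∫ s in (0 : ℝ)..1, φ (Function.update x i s)

/-- The mass of `φ` on each segment in the direction `i`, redistributed with density `ρ`. -/
noncomputable def redistribute (ρ : ℝ → ℝ) (i : ι) (φ : (ι → ℝ) → ℝ) (x : ι → ℝ) : ℝ :=
  ρ (x i) * lineAverage i φ x

theorem integral_redistribute_update {ρ : ℝ → ℝ} (hρ : ∫ s in (0 : ℝ)..1, ρ s = 1) (i : ι)
    (φ : (ι → ℝ) → ℝ) (x : ι → ℝ) :
    ∫ s in (0 : ℝ)..1, redistribute ρ i φ (Function.update x i s) =
      ∫ s in (0 : ℝ)..1, φ (Function.update x i s) := by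
  simp [redistribute, lineAverage, hρ]

theorem foldr_lineAverage_congr (φ : (ι → ℝ) → ℝ) (l : List ι) {x y : ι → ℝ}
    (hxy : ∀ j ∉ l, x j = y j) : l.foldr lineAverage φ x = l.foldr lineAverage φ y := by
  induction l generalizing x y with
  | nil => exact congrArg φ (funext fun j => hxy j (by simp))
  | cons i l ih =>
    refine intervalIntegral.integral_congr fun s _ => ih fun j hj => ?_
    rcases eq_or_ne j i with rfl | hji
    · simp
    · simpa [hji] using hxy j (by simp [hji, hj])

theorem foldr_redistribute (ρ : ℝ → ℝ) (φ : (ι → ℝ) → ℝ) {l : List ι} (hl : l.Nodup)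
    (x : ι → ℝ) : l.foldr (redistribute ρ) φ x =
      (l.map fun j => ρ (x j)).prod * l.foldr lineAverage φ x := by
  induction l generalizing x with
  | nil => simp
  | cons i l ih =>
    obtain ⟨hi, hl⟩ := List.nodup_cons.1 hl
    have h (s : ℝ) : (l.map fun j => ρ (Function.update x i s j)) = l.map fun j => ρ (x j) :=
      List.map_congr_left fun j hj => by
        rw [Function.update_of_ne (ne_of_mem_of_not_mem hj hi)]
    simp only [List.foldr_cons, List.map_cons, List.prod_cons, redistribute, lineAverage,
      ih hl, h, intervalIntegral.integral_const_mul, mul_assoc]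

variable [Fintype ι]

theorem contDiff_linePrimitive {k : ℕ∞} (i : ι) {a : (ι → ℝ) → ℝ} (ha : ContDiff ℝ k a) :
    ContDiff ℝ k (linePrimitive i a) := by
  have h : ContDiff ℝ k fun x : ι → ℝ =>
      ∫ t in (0 : ℝ)..1, a (Function.update x i (t * x i)) :=
    contDiff_intervalIntegral_param (G := fun p => a (Function.update p.1 i (p.2 * p.1 i)))
      (ha.comp (contDiff_fst.update i
        (contDiff_snd.mul ((contDiff_apply ℝ ℝ i).comp contDiff_fst))))
  have heq : linePrimitive i a = fun x => x i *
      ∫ t in (0 : ℝ)..1, a (Function.update x i (t * x i)) := by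
    funext x
    simpa [linePrimitive] using (intervalIntegral.smul_integral_comp_mul_right (a := 0) (b := 1)
      (fun s => a (Function.update x i s)) (x i)).symm
  rw [heq]
  exact (contDiff_apply ℝ ℝ i).mul h

theorem contDiff_straighten {k : ℕ∞} (i : ι) {a : (ι → ℝ) → ℝ} (ha : ContDiff ℝ k a) :
    ContDiff ℝ k (straighten i a) :=
  contDiff_id.update i (contDiff_linePrimitive i ha)

theorem det_fderiv_straighten {k : ℕ∞} (hk : 1 ≤ k) (i : ι) {a : (ι → ℝ) → ℝ}
    (ha : ContDiff ℝ k a) (x : ι → ℝ) : (fderiv ℝ (straighten i a) x).det = a x := by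
  have hk' : (k : WithTop ℕ∞) ≠ 0 := by
    simpa using (zero_lt_one.trans_le hk).ne'
  have hP := ((contDiff_linePrimitive i ha).differentiable hk' x).hasFDerivAt
  set L := fderiv ℝ (linePrimitive i a) x
  have hL : L (Pi.single i 1) = a x := by
    have h1 : HasDerivAt (fun s => linePrimitive i a (Function.update x i s))
        (L (Pi.single i 1)) (x i) := by
      have hP' : HasFDerivAt (linePrimitive i a) L (Function.update x i (x i)) := by
        simpa using hP
      exact hP'.comp_hasDerivAt (x i) (hasDerivAt_update x i (x i))
    simpa using h1.unique (hasDerivAt_linePrimitive_update ha.continuous x (x i))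
  have hD : HasFDerivAt (straighten i a)
      (ContinuousLinearMap.id ℝ (ι → ℝ) +
        (L - ContinuousLinearMap.proj i).smulRight (Pi.single i 1)) x := by
    have : straighten i a = fun x => x + (linePrimitive i a x - x i) • Pi.single i 1 := by
      ext1 x
      exact update_eq_add_smul _ _ _
    rw [this]
    exact (hasFDerivAt_id x).add ((hP.sub (hasFDerivAt_apply i x)).smul_const _)
  rw [hD.fderiv]
  have := LinearMap.transvection.det ((L - ContinuousLinearMap.proj (R := ℝ)
    (φ := fun _ : ι => ℝ) i).toLinearMap) (Pi.single i 1)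
  refine this.trans ?_
  simp [hL]

/-- If `a` is bounded below by a positive constant, `straighten i a` is a diffeomorphism. -/
theorem exists_contDiff_inverse_straighten {k : ℕ∞} (hk : 1 ≤ k) (i : ι) {a : (ι → ℝ) → ℝ} {c : ℝ}
    (hc : 0 < c) (ha : ContDiff ℝ k a) (hac : ∀ x, c ≤ a x) :
    ∃ w, ContDiff ℝ k w ∧ Function.LeftInverse w (straighten i a) ∧
      Function.RightInverse w (straighten i a) := by
  have hk' : (k : WithTop ℕ∞) ≠ 0 := by
    simpa using (zero_lt_one.trans_le hk).ne'
  have hS := contDiff_straighten i ha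
  have hdet (x : ι → ℝ) : (fderiv ℝ (straighten i a) x).det ≠ 0 := by
    rw [det_fderiv_straighten hk i ha]
    exact (hc.trans_le (hac x)).ne'
  let e (x : ι → ℝ) := (fderiv ℝ (straighten i a) x).toContinuousLinearEquivOfDetNeZero (hdet x)
  have he (x : ι → ℝ) : HasStrictFDerivAt (straighten i a) (e x : (ι → ℝ) →L[ℝ] ι → ℝ) x := by
    simpa [e] using hS.hasStrictFDerivAt hk'
  let Φ := (Equiv.ofBijective _ (bijective_straighten (i := i) hc ha.continuous hac))
    |>.toHomeomorphOfContinuousOpen hS.continuous (isOpenMap_of_hasStrictFDerivAt_equiv he)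
  exact ⟨Φ.symm, Φ.contDiff_symm (fun x => (he x).hasFDerivAt) hS,
    Φ.symm_apply_apply, Φ.apply_symm_apply⟩

/-- Two densities with the same boundary values and the same integrals over the segments of the
cube in a fixed coordinate direction are related by a diffeomorphism. -/
theorem transports_of_line_integral_eq {k : ℕ∞} (hk : 1 ≤ k) (i : ι) {a b : (ι → ℝ) → ℝ} {c : ℝ}
    (hc : 0 < c) (ha : ContDiff ℝ k a) (hb : ContDiff ℝ k b) (hac : ∀ x, c ≤ a x)
    (hbc : ∀ x, c ≤ b x) (hab : ∀ x ∈ frontier (Icc (0 : ι → ℝ) 1), a x = b x)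
    (hint : ∀ x, ∫ s in (0 : ℝ)..1, a (Function.update x i s) =
      ∫ s in (0 : ℝ)..1, b (Function.update x i s)) : Transports k a b := by
  have hk' : (k : WithTop ℕ∞) ≠ 0 := by
    simpa using (zero_lt_one.trans_le hk).ne'
  obtain ⟨v, hv, hva, hav⟩ := exists_contDiff_inverse_straighten hk i hc ha hac
  obtain ⟨w, hw, hwb, hbw⟩ := exists_contDiff_inverse_straighten hk i hc hb hbc
  have hSu (x : ι → ℝ) : straighten i b (w (straighten i a x)) = straighten i a x := hbw _
  have hu : ContDiff ℝ k (w ∘ straighten i a) := hw.comp (contDiff_straighten i ha)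
  refine ⟨w ∘ straighten i a, hu, ⟨v ∘ straighten i b, hv.comp (contDiff_straighten i hb),
    fun x => ?_, fun x => ?_⟩, ?_, ?_, ?_⟩
  · simp [hSu, hva x]
  · simp [hav (straighten i b x), hwb x]
  · intro x hx
    set y := w (straighten i a x) with hy
    have hSx : straighten i b y = straighten i a x := hSu x
    have hyx : y = Function.update x i (y i) := by
      ext j
      rcases eq_or_ne j i with rfl | hj
      · simp
      · simpa [straighten, hj] using congrFun hSx j
    have hi : linePrimitive i b y = linePrimitive i a x := by
      simpa [straighten] using congrFun hSx i
    have hma := (strictMono_linePrimitive_update (i := i) hc ha.continuous hac x).monotone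
    have hmb := strictMono_linePrimitive_update (i := i) hc hb.continuous hbc x
    rw [hyx, ← Function.update_eq_self i x, Function.update_idem] at hi
    have h0 := hma (hx.1 i)
    have h1 := hma (hx.2 i)
    simp only [Pi.zero_apply, Pi.one_apply] at h0 h1
    rw [← hi, linePrimitive_update i a x] at h0 h1
    rw [hint] at h1
    rw [intervalIntegral.integral_same] at h0
    rw [Function.comp_apply, ← hy, hyx]
    refine update_mem_unitCube hx i ⟨hmb.le_iff_le.1 ?_, hmb.le_iff_le.1 ?_⟩
    · simpa only [linePrimitive_update i b x 0, intervalIntegral.integral_same] using h0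
    · simpa only [linePrimitive_update i b x 1] using h1
  · intro x
    have h := congrArg (fun F : (ι → ℝ) → ι → ℝ => (fderiv ℝ F x).det)
      (funext hSu : straighten i b ∘ (w ∘ straighten i a) = straighten i a)
    rw [det_fderiv_straighten hk i ha, fderiv_comp x
      ((contDiff_straighten i hb).differentiable hk' _) (hu.differentiable hk' _)] at h
    rw [← h, ← det_fderiv_straighten hk i hb]
    exact (LinearMap.det_comp _ _).symm
  · intro x hx
    suffices h : linePrimitive i a x = linePrimitive i b x by
      have : straighten i a x = straighten i b x := by rw [straighten, straighten, h]
      rw [Function.comp_apply, this, hwb x]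
    obtain ⟨hxQ, j, hj⟩ := mem_frontier_unitCube.1 hx
    rcases eq_or_ne j i with rfl | hji
    · rcases hj with hj | hj
      · simp [linePrimitive, hj]
      · simpa [linePrimitive, hj] using hint x
    · refine intervalIntegral.integral_congr fun s hs => hab _ ?_
      rw [uIcc_of_le (by simpa using hxQ.1 i)] at hs
      exact mem_frontier_unitCube.2 ⟨update_mem_unitCube hxQ i ⟨hs.1, hs.2.trans (hxQ.2 i)⟩,
        j, by simpa [hji] using hj⟩

theorem contDiff_lineAverage {k : ℕ∞} (i : ι) {φ : (ι → ℝ) → ℝ} (hφ : ContDiff ℝ k φ) :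
    ContDiff ℝ k (lineAverage i φ) :=
  contDiff_intervalIntegral_param (G := fun p => φ (Function.update p.1 i p.2))
    (hφ.comp (contDiff_fst.update i contDiff_snd))

theorem measurePreserving_update {α : ι → Type*} [∀ i, MeasurableSpace (α i)]
    (μ : ∀ i, Measure (α i)) [∀ i, IsProbabilityMeasure (μ i)] (i : ι) :
    MeasurePreserving (fun p : (∀ j, α j) × α i => Function.update p.1 i p.2)
      ((Measure.pi μ).prod (μ i)) (Measure.pi μ) := by
  have hm : Measurable fun p : (∀ j, α j) × α i => Function.update p.1 i p.2 := measurable_update'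
  refine ⟨hm, (Measure.pi_eq fun s hs => ?_).symm⟩
  have hpre : (fun p : (∀ j, α j) × α i => Function.update p.1 i p.2) ⁻¹' univ.pi s =
      univ.pi (Function.update s i univ) ×ˢ s i := by
    ext p
    simp only [mem_preimage, mem_univ_pi, mem_prod]
    constructor
    · refine fun h => ⟨fun j => ?_, by simpa using h i⟩
      rcases eq_or_ne j i with rfl | hj
      · simp
      · simpa [hj] using h j
    · rintro ⟨h, hi⟩ j
      rcases eq_or_ne j i with rfl | hj
      · simpa using hi
      · simpa [hj] using h j
  rw [Measure.map_apply hm (.univ_pi hs), hpre, Measure.prod_prod, Measure.pi_pi,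
    ← Finset.prod_erase_mul _ _ (Finset.mem_univ i),
    ← Finset.prod_erase_mul (f := fun j => μ j (s j)) _ (Finset.mem_univ i)]
  simp only [Function.update_self, measure_univ, mul_one]
  congr 1
  refine Finset.prod_congr rfl fun j hj => ?_
  rw [Function.update_of_ne (Finset.ne_of_mem_erase hj)]

theorem integral_lineAverage (i : ι) {φ : (ι → ℝ) → ℝ} (hφ : Continuous φ) :
    ∫ x in Icc (0 : ι → ℝ) 1, lineAverage i φ x = ∫ x in Icc (0 : ι → ℝ) 1, φ x := by
  have : IsProbabilityMeasure (volume.restrict (Icc (0 : ℝ) 1)) := ⟨by simp⟩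
  have hint : Integrable φ (volume.restrict (Icc (0 : ι → ℝ) 1)) :=
    hφ.continuousOn.integrableOn_compact isCompact_Icc
  rw [volume_restrict_unitCube] at hint ⊢
  have hmp := measurePreserving_update (fun _ : ι => volume.restrict (Icc (0 : ℝ) 1)) i
  have hcomp := hmp.integrable_comp_of_integrable hint
  conv_rhs => rw [← hmp.map_eq, integral_map hmp.measurable.aemeasurable
    hφ.aestronglyMeasurable]
  refine Eq.trans ?_ (integral_prod _ hcomp).symm
  refine integral_congr_ae (.of_forall fun x => ?_)
  simp only [lineAverage, Function.comp_apply]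
  rw [intervalIntegral.integral_of_le zero_le_one, integral_Icc_eq_integral_Ioc]

theorem contDiff_foldr_lineAverage {k : ℕ∞} {φ : (ι → ℝ) → ℝ} (hφ : ContDiff ℝ k φ)
    (l : List ι) : ContDiff ℝ k (l.foldr lineAverage φ) := by
  induction l with
  | nil => exact hφ
  | cons i l ih => exact contDiff_lineAverage i ih

theorem integral_foldr_lineAverage {φ : (ι → ℝ) → ℝ} (hφ : Continuous φ) (l : List ι) :
    ∫ x in Icc (0 : ι → ℝ) 1, l.foldr lineAverage φ x = ∫ x in Icc (0 : ι → ℝ) 1, φ x := by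
  induction l with
  | nil => rfl
  | cons i l ih =>
    have hc : Continuous (l.foldr lineAverage φ) :=
      (contDiff_foldr_lineAverage (k := 0) (contDiff_zero.2 hφ) l).continuous
    exact (integral_lineAverage i hc).trans ih

theorem foldr_redistribute_univ_eq_zero (ρ : ℝ → ℝ) {φ : (ι → ℝ) → ℝ} (hφ : Continuous φ)
    (hint : ∫ x in Icc (0 : ι → ℝ) 1, φ x = 0) (x : ι → ℝ) :
    Finset.univ.toList.foldr (redistribute ρ) φ x = 0 := by
  rw [foldr_redistribute ρ φ (Finset.nodup_toList _)]
  have h := integral_foldr_lineAverage hφ Finset.univ.toList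
  rw [hint, setIntegral_congr_fun measurableSet_Icc fun y _ =>
    foldr_lineAverage_congr φ Finset.univ.toList (x := y) (y := x) (by simp)] at h
  simp [measureReal_def, Real.volume_Icc_pi] at h
  simp [h]

/-- The perturbations of a density allowed in the construction: bounded `C^k` functions vanishing
on the boundary of the unit cube. -/
structure IsPerturbation (k : ℕ∞) (φ : (ι → ℝ) → ℝ) : Prop where
  contDiff : ContDiff ℝ k φ
  bounded : ∃ M, ∀ x, |φ x| ≤ M
  eq_zero : ∀ x ∈ frontier (Icc (0 : ι → ℝ) 1), φ x = 0

theorem IsPerturbation.redistribute {k : ℕ∞} {ρ : ℝ → ℝ} (hρ : ContDiff ℝ k ρ)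
    (hρb : ∃ R, ∀ s, |ρ s| ≤ R) (hρ0 : ρ 0 = 0) (hρ1 : ρ 1 = 0) {φ : (ι → ℝ) → ℝ}
    (hφ : IsPerturbation k φ) (i : ι) : IsPerturbation k (redistribute ρ i φ) where
  contDiff := (hρ.comp (contDiff_apply ℝ ℝ i)).mul (contDiff_lineAverage i hφ.contDiff)
  bounded := by
    obtain ⟨R, hR⟩ := hρb
    obtain ⟨M, hM⟩ := hφ.bounded
    refine ⟨R * M, fun x => ?_⟩
    have h : |lineAverage i φ x| ≤ M := by
      simpa [lineAverage] using intervalIntegral.norm_integral_le_of_norm_le_const (a := 0) (b := 1)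
        (f := fun s => φ (Function.update x i s)) fun s _ => hM _
    rw [_root_.redistribute, abs_mul]
    exact mul_le_mul (hR _) h (abs_nonneg _) ((abs_nonneg _).trans (hR 0))
  eq_zero x hx := by
    obtain ⟨hxQ, j, hj⟩ := mem_frontier_unitCube.1 hx
    rcases eq_or_ne j i with rfl | hji
    · rcases hj with hj | hj <;> simp [_root_.redistribute, hj, hρ0, hρ1]
    · have h : lineAverage i φ x = ∫ s in (0 : ℝ)..1, 0 := by
        refine intervalIntegral.integral_congr fun s hs => hφ.eq_zero _ ?_
        rw [uIcc_of_le zero_le_one] at hs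
        exact mem_frontier_unitCube.2 ⟨update_mem_unitCube hxQ i hs, j, by simpa [hji] using hj⟩
      simp [_root_.redistribute, h]

theorem IsPerturbation.foldr_redistribute {k : ℕ∞} {ρ : ℝ → ℝ} (hρ : ContDiff ℝ k ρ)
    (hρb : ∃ R, ∀ s, |ρ s| ≤ R) (hρ0 : ρ 0 = 0) (hρ1 : ρ 1 = 0) {φ : (ι → ℝ) → ℝ}
    (hφ : IsPerturbation k φ) (l : List ι) :
    IsPerturbation k (l.foldr (_root_.redistribute ρ) φ) := by
  induction l with
  | nil => exact hφ
  | cons i l ih => exact ih.redistribute hρ hρb hρ0 hρ1 i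

theorem IsPerturbation.exists_transports_foldr {k : ℕ∞} (hk : 1 ≤ k) {ρ : ℝ → ℝ}
    (hρ : ContDiff ℝ k ρ) (hρb : ∃ R, ∀ s, |ρ s| ≤ R) (hρ0 : ρ 0 = 0) (hρ1 : ρ 1 = 0)
    (hρi : ∫ s in (0 : ℝ)..1, ρ s = 1) {φ : (ι → ℝ) → ℝ} (hφ : IsPerturbation k φ)
    (l : List ι) : ∃ M, ∀ f, ContDiff ℝ k f → (∀ x, M ≤ f x) →
      Transports k (f + φ) (f + l.foldr (_root_.redistribute ρ) φ) := by
  induction l with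
  | nil => exact ⟨0, fun f _ _ => .refl k _⟩
  | cons i l ih =>
    obtain ⟨M, hM⟩ := ih
    set ψ := l.foldr (_root_.redistribute ρ) φ
    have hψ : IsPerturbation k ψ := hφ.foldr_redistribute hρ hρb hρ0 hρ1 l
    have hψ' := hψ.redistribute hρ hρb hρ0 hρ1 i
    obtain ⟨B, hB⟩ := hψ.bounded
    obtain ⟨B', hB'⟩ := hψ'.bounded
    refine ⟨max M (max B B' + 1), fun f hf hMf => (hM f hf fun x =>
      (le_max_left _ _).trans (hMf x)).trans hk ?_⟩
    have hf1 (x : ι → ℝ) : max B B' + 1 ≤ f x := (le_max_right _ _).trans (hMf x)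
    refine transports_of_line_integral_eq hk i one_pos (hf.add hψ.contDiff)
      (hf.add hψ'.contDiff) (fun x => ?_) (fun x => ?_) (fun x hx => ?_) fun x => ?_
    · have := neg_le_of_abs_le (hB x)
      have := hf1 x
      have := le_max_left B B'
      simp only [Pi.add_apply]
      linarith
    · have := neg_le_of_abs_le (hB' x)
      have := hf1 x
      have := le_max_right B B'
      simp only [Pi.add_apply, List.foldr_cons]
      linarith
    · simp [hψ.eq_zero x hx, hψ'.eq_zero x hx, ψ]
    · simp only [Pi.add_apply, List.foldr_cons]
      have hfi := (continuous_comp_update hf.continuous x i).intervalIntegrable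
        (μ := volume) 0 1
      rw [intervalIntegral.integral_add hfi
        ((continuous_comp_update hψ.contDiff.continuous x i).intervalIntegrable 0 1),
        intervalIntegral.integral_add hfi
        ((continuous_comp_update hψ'.contDiff.continuous x i).intervalIntegrable 0 1),
        integral_redistribute_update hρi]

theorem exists_contDiff_unit_mass : ∃ ρ : ℝ → ℝ, (∀ k : ℕ∞, ContDiff ℝ k ρ) ∧
    (∃ R, ∀ s, |ρ s| ≤ R) ∧ ρ 0 = 0 ∧ ρ 1 = 0 ∧ ∫ s in (0 : ℝ)..1, ρ s = 1 := by
  let χ : ContDiffBump (1 / 2 : ℝ) := ⟨1 / 8, 1 / 4, by norm_num, by norm_num⟩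
  have hsupp : Function.support (χ.normed volume) ⊆ Ioo 0 1 := by
    rw [χ.support_normed_eq, Real.ball_eq_Ioo]
    exact Ioo_subset_Ioo (by norm_num [χ]) (by norm_num [χ])
  refine ⟨χ.normed volume, fun k => χ.contDiff_normed, ?_, ?_, ?_, ?_⟩
  · exact χ.continuous_normed.bounded_above_of_compact_support χ.hasCompactSupport_normed
  · exact Function.notMem_support.1 fun h => by simpa using hsupp h
  · exact Function.notMem_support.1 fun h => by simpa using hsupp h
  · rw [intervalIntegral.integral_eq_integral_of_support_subset
      (hsupp.trans Ioo_subset_Ioc_self), χ.integral_normed]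

/-- The conclusion of Moser's lemma for densities which are uniformly positive on the whole space
and whose difference is bounded. -/
theorem transports_add_perturbation {k : ℕ∞} (hk : 1 ≤ k) {f φ : (ι → ℝ) → ℝ} {c : ℝ} (hc : 0 < c)
    (hf : ContDiff ℝ k f) (hfc : ∀ x, c ≤ f x) (hfφ : ∀ x, c ≤ f x + φ x)
    (hφ : IsPerturbation k φ) (hint : ∫ x in Icc (0 : ι → ℝ) 1, φ x = 0) :
    Transports k (fun x => f x + φ x) f := by
  obtain ⟨ρ, hρ, hρb, hρ0, hρ1, hρi⟩ := exists_contDiff_unit_mass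
  obtain ⟨M, hM⟩ := hφ.exists_transports_foldr hk (hρ k) hρb hρ0 hρ1 hρi Finset.univ.toList
  rw [show Finset.univ.toList.foldr (redistribute ρ) φ = 0 from
    funext fun x => foldr_redistribute_univ_eq_zero ρ hφ.contDiff.continuous hint x] at hM
  obtain ⟨N, hN⟩ := exists_nat_gt (M / c)
  rw [div_lt_iff₀ hc] at hN
  suffices h : ∀ j ≤ N + 1,
      Transports k (fun x => f x + (j / (N + 1 : ℕ) : ℝ) * φ x) f by
    have := h (N + 1) le_rfl
    simpa only [div_self (Nat.cast_ne_zero (R := ℝ).2 N.succ_ne_zero), one_mul] using this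
  intro j
  induction j with
  | zero => simpa using Transports.refl k f
  | succ j ih =>
    intro hj
    refine Transports.trans hk ?_ (ih (by omega))
    have hN0 : (0 : ℝ) < (N + 1 : ℕ) := by positivity
    refine .of_const_mul hN0.ne' ?_
    set t : ℝ := j / (N + 1 : ℕ) with ht
    have ht0 : 0 ≤ t := by positivity
    have ht1 : t ≤ 1 := (div_le_one hN0).2 (by exact_mod_cast (by omega : j ≤ N + 1))
    have hlow (x : ι → ℝ) : M ≤ (N + 1 : ℕ) * (f x + t * φ x) := by
      have h1 : c ≤ f x + t * φ x := by nlinarith [hfc x, hfφ x]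
      have h2 := mul_le_mul_of_nonneg_left h1 hN0.le
      push_cast at h2 ⊢
      linarith
    convert hM (fun x => (N + 1 : ℕ) * (f x + t * φ x))
      (contDiff_const.mul (hf.add (contDiff_const.mul hφ.contDiff))) hlow using 1
    · funext x
      simp only [Pi.add_apply, ht]
      push_cast
      field_simp
      ring
    · simp

end Coordinate

theorem exists_pos_le_of_eq_one_off_compact {X : Type*} [TopologicalSpace X] {f : X → ℝ}
    (hf : Continuous f) (hpos : ∀ x, 0 < f x) {K : Set X} (hK : IsCompact K)
    (hfK : ∀ x ∉ K, f x = 1) : ∃ c, 0 < c ∧ ∀ x, c ≤ f x := by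
  rcases K.eq_empty_or_nonempty with rfl | hne
  · exact ⟨1, one_pos, fun x => (hfK x (notMem_empty x)).ge⟩
  · obtain ⟨y, -, hy⟩ := hK.exists_isMinOn hne hf.continuousOn
    refine ⟨min (f y) 1, lt_min (hpos y) one_pos, fun x => ?_⟩
    by_cases hx : x ∈ K
    · exact (min_le_left _ _).trans (hy hx)
    · exact (min_le_right _ _).trans (hfK x hx).ge

/-- **Moser's Lemma 2 for the cube.**  If `h, g : ℝⁿ → ℝ` are positive `C^k` functions
which agree on `∂Q`, `Q = [0,1]ⁿ`, and have equal integrals over `Q`, then there is a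
`C^k` diffeomorphism `u` of `ℝⁿ` with `g(u(x)) · det(Du(x)) = h(x)` on `Q` and
`u = id` on `∂Q`. -/
theorem moser_cube (n k : ℕ) (hn : 1 ≤ n) (hk : 1 ≤ k)
    (h g : (Fin n → ℝ) → ℝ)
    (hh : ContDiff ℝ (k : ℕ∞) h) (hg : ContDiff ℝ (k : ℕ∞) g)
    (hhpos : ∀ x, 0 < h x) (hgpos : ∀ x, 0 < g x)
    (hbdry : ∀ x ∈ frontier (Set.Icc (0 : Fin n → ℝ) 1), h x = g x)
    (hint : ∫ x in Set.Icc (0 : Fin n → ℝ) 1, h x = ∫ x in Set.Icc (0 : Fin n → ℝ) 1, g x) :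
    ∃ u : (Fin n → ℝ) → (Fin n → ℝ),
      ContDiff ℝ (k : ℕ∞) u ∧
      (∃ w, ContDiff ℝ (k : ℕ∞) w ∧ Function.LeftInverse w u ∧ Function.RightInverse w u) ∧
      (∀ x ∈ Set.Icc (0 : Fin n → ℝ) 1,
        g (u x) * LinearMap.det (fderiv ℝ u x).toLinearMap = h x) ∧
      (∀ x ∈ frontier (Set.Icc (0 : Fin n → ℝ) 1), u x = x) := by
  have hk1 : (1 : ℕ∞) ≤ k := by exact_mod_cast hk
  let χ : ContDiffBump (0 : Fin n → ℝ) := ⟨1, 2, one_pos, one_lt_two⟩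
  have hχQ : ∀ x ∈ Icc (0 : Fin n → ℝ) 1, χ x = 1 := fun x hx => χ.one_of_mem_closedBall <| by
    rw [mem_closedBall_zero_iff, pi_norm_le_iff_of_nonneg zero_le_one]
    exact fun i => abs_le.2 ⟨(by norm_num : (-1 : ℝ) ≤ 0).trans (hx.1 i), hx.2 i⟩
  have hχK : ∀ x ∉ Metric.closedBall (0 : Fin n → ℝ) 2, χ x = 0 := fun x hx =>
    χ.zero_of_le_dist (not_le.1 (mt Metric.mem_closedBall.2 hx)).le
  have cutoff : ∀ f : (Fin n → ℝ) → ℝ, ContDiff ℝ (k : ℕ∞) f → (∀ x, 0 < f x) →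
      ContDiff ℝ (k : ℕ∞) (fun x => χ x * f x + (1 - χ x)) ∧
        ∃ c, 0 < c ∧ ∀ x, c ≤ χ x * f x + (1 - χ x) := by
    intro f hf hpos
    have hC : ContDiff ℝ (k : ℕ∞) (fun x => χ x * f x + (1 - χ x)) :=
      (χ.contDiff.mul hf).add (contDiff_const.sub χ.contDiff)
    refine ⟨hC, exists_pos_le_of_eq_one_off_compact hC.continuous (fun x => ?_)
      (isCompact_closedBall 0 2) fun x hx => by simp [hχK x hx]⟩
    rcases (χ.nonneg (x := x)).eq_or_lt with h0 | h0
    · simp [← h0]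
    · have := mul_pos h0 (hpos x)
      have := χ.le_one (x := x)
      linarith
  obtain ⟨hh', c₁, hc₁, hh1⟩ := cutoff h hh hhpos
  obtain ⟨hg', c₂, hc₂, hg2⟩ := cutoff g hg hgpos
  have hφC : ContDiff ℝ (k : ℕ∞) fun x => χ x * (h x - g x) := χ.contDiff.mul (hh.sub hg)
  have hφ : IsPerturbation (k : ℕ∞) fun x => χ x * (h x - g x) := by
    refine ⟨hφC, ?_, fun x hx => by simp [hbdry x hx]⟩
    exact hφC.continuous.bounded_above_of_compact_support χ.hasCompactSupport.mul_right
  have hφint : ∫ x in Icc (0 : Fin n → ℝ) 1, χ x * (h x - g x) = 0 := by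
    rw [setIntegral_congr_fun (g := fun x => h x - g x) measurableSet_Icc
      fun x hx => by simp [hχQ x hx], integral_sub
      (hh.continuous.continuousOn.integrableOn_compact isCompact_Icc)
      (hg.continuous.continuousOn.integrableOn_compact isCompact_Icc), hint, sub_self]
  have hsum (x : Fin n → ℝ) : χ x * g x + (1 - χ x) + χ x * (h x - g x) =
      χ x * h x + (1 - χ x) := by ring
  obtain ⟨u, hu, hw, huQ, hdu, hub⟩ := transports_add_perturbation hk1 (lt_min hc₁ hc₂) hg'
    (fun x => (min_le_right _ _).trans (hg2 x))
    (fun x => (min_le_left _ _).trans ((hh1 x).trans_eq (hsum x).symm)) hφ hφint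
  refine ⟨u, hu, hw, fun x hx => ?_, hub⟩
  have := hdu x
  simp only [hsum] at this
  rw [hχQ x hx, hχQ _ (huQ hx)] at this
  simpa [ContinuousLinearMap.det] using this
end

section
/- Let n ≥ 2 and k ≥ 1 be integers, B = [−1,1]ⁿ ⊂ ℝⁿ, and let f be a positive C^k function on (a neighborhood of) B which equals 1 at every point of B having at least two coordinates in {−1, 0, 1} (the codimension-two faces of each of the 2ⁿ unit subcubes of B with vertices at integer coordinates). Define ∂'B = ∂B ∪ ⋃_{j=1}^{n} { x ∈ B : x_j = 0 } (the boundary of B together with the coordinate hyperplane slices of B). Then there exists a C^k diffeomorphism v : ℝⁿ → ℝⁿ such that det(Dv(x)) · f(v(x)) = 1 for all x ∈ ∂'B and v(x) = x for all x ∈ ∂'B. Furthermore, if f ≡ 1 on a neighborhood of ∂B, then v can be chosen so that v equals the identity on a neighborhood of ∂B. -/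
open Set

/-- `∂'B` for `B = [-1,1]ⁿ`: the boundary of `B` together with the slices of `B` by the
coordinate hyperplanes `{x_j = 0}`. -/
def gridBdry (n : ℕ) : Set (Fin n → ℝ) :=
  frontier (Set.Icc (-1 : Fin n → ℝ) 1) ∪
    ⋃ j : Fin n, {x ∈ Set.Icc (-1 : Fin n → ℝ) 1 | x j = 0}

/-- The desired properties of the diffeomorphism `v` in the grid lemma. -/
def GridSol (n : ℕ) (k : ℕ) (f : (Fin n → ℝ) → ℝ) (v : (Fin n → ℝ) → (Fin n → ℝ)) : Prop :=
  ContDiff ℝ (k : ℕ∞) v ∧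
  (∃ w, ContDiff ℝ (k : ℕ∞) w ∧ Function.LeftInverse w v ∧ Function.RightInverse w v) ∧
  (∀ x ∈ gridBdry n, LinearMap.det (fderiv ℝ v x).toLinearMap * f (v x) = 1) ∧
  (∀ x ∈ gridBdry n, v x = x)

open Function Topology ContDiff Manifold

/-- A bijective `C^m` self-map whose derivative has nonzero determinant everywhere has a
two-sided `C^m` inverse. -/
theorem exists_contDiff_inverse {n : ℕ} {m : WithTop ℕ∞} (hm : m ≠ 0)
    {v : (Fin n → ℝ) → (Fin n → ℝ)} (hv : ContDiff ℝ m v) (hbij : Bijective v)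
    (hdet : ∀ x, LinearMap.det (fderiv ℝ v x).toLinearMap ≠ 0) :
    ∃ w, ContDiff ℝ m w ∧ LeftInverse w v ∧ RightInverse w v := by
  obtain ⟨w, hl, hr⟩ := bijective_iff_has_inverse.1 hbij
  refine ⟨w, contDiff_iff_contDiffAt.2 fun y => ?_, hl, hr⟩
  obtain ⟨x, rfl⟩ := hbij.2 y
  have hd : HasFDerivAt v
      ((fderiv ℝ v x).toContinuousLinearEquivOfDetNeZero (hdet x) : _ →L[ℝ] _) x := by
    rw [ContinuousLinearMap.coe_toContinuousLinearEquivOfDetNeZero]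
    exact (hv.differentiable hm x).hasFDerivAt
  refine (hv.contDiffAt.to_localInverse hd hm).congr_of_eventuallyEq ?_
  filter_upwards [(hv.contDiffAt.hasStrictFDerivAt' hd hm).eventually_right_inverse] with y hy
  exact hbij.1 ((hr y).trans hy.symm)

/-- The map moving each point `x` by `h x` in the direction of the `j`-th coordinate. -/
def coordShear {n : ℕ} (j : Fin n) (h : (Fin n → ℝ) → ℝ) (x : Fin n → ℝ) : Fin n → ℝ :=
  x + h x • Pi.single j 1

theorem contDiff_coordShear {n : ℕ} {m : WithTop ℕ∞} (j : Fin n) {h : (Fin n → ℝ) → ℝ}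
    (hh : ContDiff ℝ m h) : ContDiff ℝ m (coordShear j h) :=
  contDiff_id.add (hh.smul contDiff_const)

theorem det_fderiv_coordShear {n : ℕ} (j : Fin n) {h : (Fin n → ℝ) → ℝ} {x : Fin n → ℝ}
    (hh : DifferentiableAt ℝ h x) :
    LinearMap.det (fderiv ℝ (coordShear j h) x).toLinearMap =
      1 + fderiv ℝ h x (Pi.single j 1) := by
  have hd : HasFDerivAt (coordShear j h) (ContinuousLinearMap.id ℝ (Fin n → ℝ) +
      (fderiv ℝ h x).smulRight (Pi.single j 1)) x :=
    (hasFDerivAt_id x).add (hh.hasFDerivAt.smul_const _)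
  rw [hd.fderiv]
  exact LinearMap.transvection.det (fderiv ℝ h x).toLinearMap (Pi.single j 1)

theorem hasDerivAt_comp_update {n : ℕ} (j : Fin n) {h : (Fin n → ℝ) → ℝ}
    (hh : Differentiable ℝ h) (x : Fin n → ℝ) (t : ℝ) :
    HasDerivAt (fun s => h (update x j s)) (fderiv ℝ h (update x j t) (Pi.single j 1)) t :=
  (hh (update x j t)).hasFDerivAt.comp_hasDerivAt t (hasDerivAt_update x j t)

theorem bijective_coordShear {n : ℕ} (j : Fin n) {h : (Fin n → ℝ) → ℝ}
    (hh : Differentiable ℝ h) (hpos : ∀ x, 0 < 1 + fderiv ℝ h x (Pi.single j 1))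
    (hout : ∀ x : Fin n → ℝ, 2 ≤ |x j| → h x = 0) : Bijective (coordShear j h) := by
  have hder (x : Fin n → ℝ) (t : ℝ) : HasDerivAt (fun s => s + h (update x j s))
      (1 + fderiv ℝ h (update x j t) (Pi.single j 1)) t :=
    (hasDerivAt_id t).add (hasDerivAt_comp_update j hh x t)
  have hmono (x : Fin n → ℝ) : StrictMono fun s => s + h (update x j s) :=
    strictMono_of_deriv_pos fun t => by
      rw [(hder x t).deriv]
      exact hpos _
  constructor
  · intro x y hxy
    have hoff (i : Fin n) (hi : i ≠ j) : x i = y i := by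
      simpa [coordShear, hi] using congrFun hxy i
    have hy : update x j (y j) = y := by
      ext i
      rcases eq_or_ne i j with rfl | hi
      · simp
      · simp [hi, hoff i hi]
    have hj : x j = y j := (hmono x).injective (by
      simpa [coordShear, hy] using congrFun hxy j)
    ext i
    rcases eq_or_ne i j with rfl | hi
    exacts [hj, hoff i hi]
  · intro y
    set T := max |y j| 2
    have hT : 2 ≤ T := le_max_right _ _
    have hyT : |y j| ≤ T := le_max_left _ _
    have hend (t : ℝ) (ht : 2 ≤ |t|) : t + h (update y j t) = t := by
      rw [hout _ (by simpa using ht), add_zero]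
    have hcont : Continuous fun s => s + h (update y j s) :=
      continuous_iff_continuousAt.2 fun t => (hder y t).continuousAt
    obtain ⟨t, -, ht⟩ := intermediate_value_Icc (show -T ≤ T by linarith) hcont.continuousOn
      (show y j ∈ Icc _ _ by
        rw [hend (-T) (by rwa [abs_neg, abs_of_nonneg (by linarith)]),
          hend T (by rwa [abs_of_nonneg (by linarith)])]
        exact abs_le.1 hyT)
    refine ⟨update y j t, ?_⟩
    ext i
    rcases eq_or_ne i j with rfl | hi
    · simpa [coordShear] using ht
    · simp [coordShear, hi]

/-- A smooth profile with unit slope at `0`, supported in `[-1/2, 1/2]`, whose derivative is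
almost nonnegative. -/
theorem exists_profile (m : ℕ∞) {η M : ℝ} (hη : 0 < η) (hη1 : η ≤ 1) (hM : 0 ≤ M) :
    ∃ ψ : ℝ → ℝ, ContDiff ℝ m ψ ∧ Differentiable ℝ ψ ∧ ψ 0 = 0 ∧ deriv ψ 0 = 1 ∧
      (∀ t, 1 / 2 ≤ |t| → ψ t = 0 ∧ deriv ψ t = 0) ∧
      ∀ t g, -1 + η ≤ g → |g| ≤ M → 0 < 1 + deriv ψ t * g := by
  let b : ContDiffBump (0 : ℝ) := ⟨1 / 8, 1 / 4, by norm_num, by norm_num⟩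
  have hb : ContDiff ℝ ∞ b := b.contDiff
  have hbd : Differentiable ℝ b := hb.differentiable (by simp)
  obtain ⟨C, hC⟩ : ∃ C, ∀ t, ‖deriv b t‖ ≤ C :=
    b.hasCompactSupport.deriv.exists_bound_of_continuous (hb.continuous_deriv (by simp))
  have hC0 : 0 ≤ C := (norm_nonneg _).trans (hC 0)
  have hCM : 0 ≤ C * M := mul_nonneg hC0 hM
  set δ := η / (2 * (C * M) + 1) with hδ
  have hδ0 : 0 < δ := by positivity
  have hδη : δ * (2 * (C * M)) < η := by
    rw [hδ, div_mul_eq_mul_div, div_lt_iff₀ (by positivity)]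
    nlinarith
  let ψ : ℝ → ℝ := fun t => δ * Real.arctan (t / δ) * b t
  have hψ (t : ℝ) : HasDerivAt ψ
      ((1 + (t / δ) ^ 2)⁻¹ * b t + δ * Real.arctan (t / δ) * deriv b t) t := by
    have h1 : HasDerivAt (fun t => δ * Real.arctan (t / δ)) ((1 + (t / δ) ^ 2)⁻¹) t := by
      have := (((hasDerivAt_id t).div_const δ).arctan).const_mul δ
      refine this.congr_deriv ?_
      rw [id]
      field_simp
    exact h1.mul (hbd t).hasDerivAt
  have hvanish (t : ℝ) (ht : 1 / 4 < |t|) : ψ =ᶠ[𝓝 t] 0 := by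
    filter_upwards [(isOpen_lt continuous_const continuous_abs).mem_nhds ht] with s hs
    have : b s = 0 := b.zero_of_le_dist (by simpa [b] using le_of_lt hs)
    simp [ψ, this]
  refine ⟨ψ, ?_, fun t => (hψ t).differentiableAt, by simp [ψ], ?_, fun t ht => ?_,
    fun t g hg hgM => ?_⟩
  · exact (contDiff_const.mul (contDiff_id.div_const δ).arctan).mul b.contDiff
  · rw [(hψ 0).deriv]
    simp [b.one_of_mem_closedBall (x := 0) (by simp [b])]
  · have := hvanish t (by linarith)
    exact ⟨this.self_of_nhds, by simpa using this.deriv_eq⟩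
  · rw [(hψ t).deriv]
    set σ := (1 + (t / δ) ^ 2)⁻¹ * b t
    have hs0 : 0 ≤ (1 + (t / δ) ^ 2)⁻¹ := by positivity
    have hs1 : (1 + (t / δ) ^ 2)⁻¹ ≤ 1 := inv_le_one_of_one_le₀ (by nlinarith [sq_nonneg (t / δ)])
    have hσ0 : 0 ≤ σ := mul_nonneg hs0 b.nonneg
    have hσ1 : σ ≤ 1 := mul_le_one₀ hs1 b.nonneg b.le_one
    have hat : |Real.arctan (t / δ)| ≤ 2 := by
      have := Real.arctan_lt_pi_div_two (t / δ)
      have := Real.neg_pi_div_two_lt_arctan (t / δ)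
      have := Real.pi_le_four
      exact abs_le.2 ⟨by linarith, by linarith⟩
    have he : |δ * Real.arctan (t / δ) * deriv b t * g| ≤ δ * 2 * C * M := by
      rw [abs_mul, abs_mul, abs_mul, abs_of_pos hδ0]
      have := hC t
      rw [Real.norm_eq_abs] at this
      gcongr
    have := (abs_le.1 he).1
    nlinarith [mul_le_mul_of_nonneg_left hg hσ0]

/-- The displacement in the `j`-th direction with normal derivative `G` along each of the
hyperplanes `x j = -1`, `x j = 0` and `x j = 1`, where `ψ` is a profile of unit slope at `0`. -/
def gridDisp {n : ℕ} (ψ : ℝ → ℝ) (G : (Fin n → ℝ) → ℝ) (j : Fin n) (x : Fin n → ℝ) : ℝ :=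
  ψ (x j + 1) * G (update x j (-1)) + ψ (x j) * G (update x j 0) +
    ψ (x j - 1) * G (update x j 1)

theorem contDiff_gridDisp {n : ℕ} {m : WithTop ℕ∞} {ψ : ℝ → ℝ} {G : (Fin n → ℝ) → ℝ}
    (hψ : ContDiff ℝ m ψ) (hG : ContDiff ℝ m G) (j : Fin n) :
    ContDiff ℝ m (gridDisp ψ G j) := by
  have hj : ContDiff ℝ m fun x : Fin n → ℝ => x j := contDiff_apply ℝ ℝ j
  have hu (c : ℝ) : ContDiff ℝ m fun x : Fin n → ℝ => G (update x j c) := by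
    refine hG.comp (contDiff_pi.2 fun i => ?_)
    rcases eq_or_ne i j with rfl | hi
    · simpa using contDiff_const
    · simpa [hi] using contDiff_apply ℝ ℝ i
  exact (((hψ.comp (hj.add contDiff_const)).mul (hu _)).add ((hψ.comp hj).mul (hu _))).add
    ((hψ.comp (hj.sub contDiff_const)).mul (hu _))

theorem fderiv_gridDisp {n : ℕ} {ψ : ℝ → ℝ} {G : (Fin n → ℝ) → ℝ} (hψ : Differentiable ℝ ψ)
    {j : Fin n} (hd : Differentiable ℝ (gridDisp ψ G j)) (x : Fin n → ℝ) :
    fderiv ℝ (gridDisp ψ G j) x (Pi.single j 1) =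
      deriv ψ (x j + 1) * G (update x j (-1)) + deriv ψ (x j) * G (update x j 0) +
        deriv ψ (x j - 1) * G (update x j 1) := by
  have h1 := hasDerivAt_comp_update j hd x (x j)
  rw [update_eq_self] at h1
  refine h1.unique ?_
  have h2 : (fun s => gridDisp ψ G j (update x j s)) = fun s =>
      ψ (s + 1) * G (update x j (-1)) + ψ s * G (update x j 0) +
        ψ (s - 1) * G (update x j 1) := by
    ext s
    simp [gridDisp]
  rw [h2]
  exact ((((hψ _).hasDerivAt.comp_add_const (x j) 1).mul_const _).add
    ((hψ _).hasDerivAt.mul_const _)).add (((hψ _).hasDerivAt.comp_sub_const (x j) 1).mul_const _)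

theorem mem_interior_Icc_neg_one_one_iff {n : ℕ} {x : Fin n → ℝ} :
    x ∈ interior (Icc (-1 : Fin n → ℝ) 1) ↔ ∀ i, |x i| < 1 := by
  simp [← pi_univ_Icc, interior_pi_set finite_univ, abs_lt]

theorem exists_abs_eq_one_of_mem_frontier {n : ℕ} {x : Fin n → ℝ}
    (hx : x ∈ frontier (Icc (-1 : Fin n → ℝ) 1)) : ∃ i, |x i| = 1 := by
  have hB : x ∈ Icc (-1 : Fin n → ℝ) 1 := isClosed_Icc.frontier_subset hx
  obtain ⟨i, hi⟩ := not_forall.1 (mt mem_interior_Icc_neg_one_one_iff.2 hx.2)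
  exact ⟨i, le_antisymm (abs_le.2 ⟨hB.1 i, hB.2 i⟩) (not_lt.1 hi)⟩

theorem exists_of_mem_gridBdry {n : ℕ} {x : Fin n → ℝ} (hx : x ∈ gridBdry n) :
    x ∈ Icc (-1 : Fin n → ℝ) 1 ∧ ∃ i, x i = -1 ∨ x i = 0 ∨ x i = 1 := by
  rcases hx with hx | hx
  · obtain ⟨i, hi⟩ := exists_abs_eq_one_of_mem_frontier hx
    refine ⟨isClosed_Icc.frontier_subset hx, i, ?_⟩
    rcases eq_or_eq_neg_of_abs_eq hi with h | h <;> simp [h]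
  · obtain ⟨j, hB, hj⟩ := mem_iUnion.1 hx
    exact ⟨hB, j, .inr (.inl hj)⟩

/-- Composing the coordinate shears along a set of directions. -/
theorem exists_comp_coordShear {n : ℕ} {m : WithTop ℕ∞} (hm : m ≠ 0)
    (h : Fin n → (Fin n → ℝ) → ℝ) (hh : ∀ j, ContDiff ℝ m (h j))
    (hpos : ∀ j x, 0 < 1 + fderiv ℝ (h j) x (Pi.single j 1))
    (hout : ∀ j, ∀ x : Fin n → ℝ, 2 ≤ |x j| → h j x = 0) (s : Finset (Fin n)) :
    ∃ v, ContDiff ℝ m v ∧ (∃ w, ContDiff ℝ m w ∧ LeftInverse w v ∧ RightInverse w v) ∧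
      ∀ x, (∀ j, h j x = 0) → v x = x ∧ LinearMap.det (fderiv ℝ v x).toLinearMap =
        ∏ j ∈ s, (1 + fderiv ℝ (h j) x (Pi.single j 1)) := by
  classical
  induction s using Finset.induction_on with
  | empty =>
    refine ⟨id, contDiff_id, ⟨id, contDiff_id, fun _ => rfl, fun _ => rfl⟩, fun x _ => ⟨rfl, ?_⟩⟩
    rw [fderiv_id]
    exact LinearMap.det_id
  | insert j s hj ih =>
    obtain ⟨v, hv, ⟨w, hw, hl, hr⟩, hfix⟩ := ih
    have hd : Differentiable ℝ (h j) := (hh j).differentiable hm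
    have hS := contDiff_coordShear j (hh j)
    obtain ⟨w', hw', hl', hr'⟩ := exists_contDiff_inverse hm hS
      (bijective_coordShear j hd (hpos j) (hout j)) fun x => by
        rw [det_fderiv_coordShear j (hd x)]
        exact (hpos j x).ne'
    refine ⟨coordShear j (h j) ∘ v, hS.comp hv, ⟨w ∘ w', hw.comp hw', hl'.comp hl,
      hr'.comp hr⟩, fun x hx => ?_⟩
    obtain ⟨hvx, hdet⟩ := hfix x hx
    refine ⟨by simp [coordShear, hvx, hx j], ?_⟩
    rw [fderiv_comp x (hS.differentiable hm _) (hv.differentiable hm x), hvx,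
      ContinuousLinearMap.toLinearMap_comp, LinearMap.det_comp, hdet,
      det_fderiv_coordShear j (hd x), Finset.prod_insert hj]

/-- The grid lemma for a globally defined relative density `G`. -/
theorem exists_diffeo_det_eq_one_add {n : ℕ} {m : ℕ∞} (hm : (m : WithTop ℕ∞) ≠ 0)
    {G : (Fin n → ℝ) → ℝ} (hG : ContDiff ℝ m G) {η M : ℝ} (hη : 0 < η) (hη1 : η ≤ 1)
    (hM : 0 ≤ M) (hlow : ∀ x, -1 + η ≤ G x) (hGM : ∀ x, |G x| ≤ M)
    (hfaces : ∀ x : Fin n → ℝ, x ∈ Icc (-1 : Fin n → ℝ) 1 →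
      (∃ i j : Fin n, i ≠ j ∧ (x i = -1 ∨ x i = 0 ∨ x i = 1) ∧
        (x j = -1 ∨ x j = 0 ∨ x j = 1)) → G x = 0) :
    ∃ v, ContDiff ℝ m v ∧ (∃ w, ContDiff ℝ m w ∧ LeftInverse w v ∧ RightInverse w v) ∧
      (∀ x ∈ gridBdry n, LinearMap.det (fderiv ℝ v x).toLinearMap = 1 + G x) ∧
      (∀ x ∈ gridBdry n, v x = x) ∧
      ∀ U : Set (Fin n → ℝ), IsOpen U → (∀ x : Fin n → ℝ, (∃ i, 1 ≤ |x i|) → x ∈ U) →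
        (∀ x ∈ U, G x = 0) →
        ∃ W : Set (Fin n → ℝ), IsOpen W ∧ frontier (Icc (-1 : Fin n → ℝ) 1) ⊆ W ∧
          ∀ x ∈ W, v x = x := by
  obtain ⟨ψ, hψ, hψd, hψ0, hψ1, hψout, hψpos⟩ := exists_profile m hη hη1 hM
  have hh (j : Fin n) := contDiff_gridDisp hψ hG j
  have hder (j : Fin n) := fderiv_gridDisp hψd ((hh j).differentiable hm)
  have hfar (t : ℝ) (ht : 1 / 2 ≤ t) : ψ t = 0 ∧ deriv ψ t = 0 :=
    hψout t (ht.trans (le_abs_self t))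
  have hfar' (t : ℝ) (ht : t ≤ -(1 / 2)) : ψ t = 0 ∧ deriv ψ t = 0 :=
    hψout t (le_trans (by linarith) (neg_le_abs t))
  have hpos (j : Fin n) (x : Fin n → ℝ) :
      0 < 1 + fderiv ℝ (gridDisp ψ G j) x (Pi.single j 1) := by
    rw [hder j x]
    rcases le_total (x j) (-(1 / 2)) with h | h
    · rw [(hfar' (x j) h).2, (hfar' (x j - 1) (by linarith)).2]
      simpa using hψpos (x j + 1) _ (hlow _) (hGM _)
    · rw [(hfar (x j + 1) (by linarith)).2]
      rcases le_total (x j) (1 / 2) with h' | h'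
      · rw [(hfar' (x j - 1) (by linarith)).2]
        simpa using hψpos (x j) _ (hlow _) (hGM _)
      · rw [(hfar (x j) h').2]
        simpa using hψpos (x j - 1) _ (hlow _) (hGM _)
  have hout (j : Fin n) (x : Fin n → ℝ) (hx : 2 ≤ |x j|) : gridDisp ψ G j x = 0 := by
    rcases le_abs.1 hx with h | h
    · simp [gridDisp, (hfar (x j + 1) (by linarith)).1, (hfar (x j) (by linarith)).1,
        (hfar (x j - 1) (by linarith)).1]
    · simp [gridDisp, (hfar' (x j + 1) (by linarith)).1, (hfar' (x j) (by linarith)).1,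
        (hfar' (x j - 1) (by linarith)).1]
  obtain ⟨v, hv, hinv, hfix⟩ := exists_comp_coordShear hm _ hh hpos hout Finset.univ
  have hoff {x : Fin n → ℝ} (hB : x ∈ Icc (-1 : Fin n → ℝ) 1) {i : Fin n}
      (hi : x i = -1 ∨ x i = 0 ∨ x i = 1) {j : Fin n} (hj : j ≠ i) {c : ℝ}
      (hc : c = -1 ∨ c = 0 ∨ c = 1) : G (update x j c) = 0 := by
    refine hfaces _ ⟨fun l => ?_, fun l => ?_⟩ ⟨i, j, hj.symm, by simpa [hj.symm] using hi,
      by simpa using hc⟩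
    all_goals
      rcases eq_or_ne l j with rfl | hl
      · rcases hc with rfl | rfl | rfl <;> simp
    · simpa [hl] using hB.1 l
    · simpa [hl] using hB.2 l
  have hself {x : Fin n → ℝ} {i : Fin n} (hi : x i = -1 ∨ x i = 0 ∨ x i = 1) :
      gridDisp ψ G i x = 0 ∧ fderiv ℝ (gridDisp ψ G i) x (Pi.single i 1) = G x := by
    have h1 := hfar 1 (by norm_num)
    have h2 := hfar 2 (by norm_num)
    have h1' := hfar' (-1) (by norm_num)
    have h2' := hfar' (-2) (by norm_num)
    have hx := update_eq_self i x
    rw [hder i x, gridDisp]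
    rcases hi with hi | hi | hi <;> rw [hi] at hx ⊢ <;>
      norm_num [h1, h2, h1', h2', hψ0, hψ1, hx]
  have hzero (x : Fin n → ℝ) (hx : x ∈ gridBdry n) (j : Fin n) : gridDisp ψ G j x = 0 := by
    obtain ⟨hB, i, hi⟩ := exists_of_mem_gridBdry hx
    rcases eq_or_ne j i with rfl | hj
    · exact (hself hi).1
    · simp [gridDisp, hoff hB hi hj]
  refine ⟨v, hv, hinv, fun x hx => ?_, fun x hx => (hfix x (hzero x hx)).1,
    fun U hU hUout hUG => ?_⟩
  · obtain ⟨hB, i, hi⟩ := exists_of_mem_gridBdry hx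
    rw [(hfix x (hzero x hx)).2, Finset.prod_eq_single i, (hself hi).2]
    · intro j _ hj
      rw [hder j x]
      simp [hoff hB hi hj]
    · simp
  · refine ⟨⋂ j, ({x | 1 / 2 < |x j|} ∪ {x | update x j 0 ∈ U}),
      isOpen_iInter_of_finite fun j => IsOpen.union
        (isOpen_lt continuous_const (continuous_apply j).abs)
        (hU.preimage (continuous_id.update j continuous_const)), fun x hx => ?_,
      fun x hx => (hfix x fun j => ?_).1⟩
    · obtain ⟨i, hi⟩ := exists_abs_eq_one_of_mem_frontier hx
      refine mem_iInter.2 fun j => ?_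
      rcases eq_or_ne i j with rfl | hij
      · left
        rw [mem_ofPred_eq, hi]
        norm_num
      · exact .inr (hUout _ ⟨i, by simp [hij, hi]⟩)
    · have h1 : G (update x j (-1)) = 0 := hUG _ (hUout _ ⟨j, by simp⟩)
      have h2 : G (update x j 1) = 0 := hUG _ (hUout _ ⟨j, by simp⟩)
      rcases mem_iInter.1 hx j with h | h
      · simp [gridDisp, h1, h2, (hψout (x j) (le_of_lt h)).1]
      · simp [gridDisp, h1, h2, hUG _ h]

/-- A positive `C^m` function near `B` has reciprocal agreeing on `B` with `1 + G`, where `G` is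
globally defined, bounded, bounded away from `-1`, and vanishes off the neighborhood. -/
theorem exists_density_extension {n : ℕ} {m : ℕ∞} {f : (Fin n → ℝ) → ℝ}
    {V V' : Set (Fin n → ℝ)} (hV : IsOpen V) (hf : ContDiffOn ℝ m f V)
    (hfpos : ∀ x ∈ V, 0 < f x) (hV' : IsOpen V') (hVV' : V' ⊆ V)
    (hBV' : Icc (-1 : Fin n → ℝ) 1 ⊆ V') :
    ∃ (G : (Fin n → ℝ) → ℝ) (η M : ℝ), ContDiff ℝ m G ∧ 0 < η ∧ η ≤ 1 ∧ 0 ≤ M ∧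
      (∀ x, -1 + η ≤ G x) ∧ (∀ x, |G x| ≤ M) ∧
      (∀ x ∈ Icc (-1 : Fin n → ℝ) 1, G x = (f x)⁻¹ - 1) ∧
      (∀ x ∉ V', G x = 0) ∧ ∀ x, f x = 1 → G x = 0 := by
  have hball : Icc (-1 : Fin n → ℝ) 1 ⊆ Metric.ball 0 2 := fun x hx => by
    rw [mem_ball_zero_iff]
    refine ((pi_norm_le_iff_of_nonneg zero_le_one).2 fun i => ?_).trans_lt one_lt_two
    exact abs_le.2 ⟨hx.1 i, hx.2 i⟩
  have hO : IsOpen (V' ∩ Metric.ball 0 2) := hV'.inter Metric.isOpen_ball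
  obtain ⟨χ, h0, h1, hχ⟩ := exists_contMDiffMap_zero_one_nhds_of_isClosed (n := m)
    𝓘(ℝ, Fin n → ℝ) hO.isClosed_compl (isClosed_Icc (a := (-1 : Fin n → ℝ)) (b := 1))
    (disjoint_compl_left_iff_subset.2 (subset_inter hBV' hball))
  have hχd : ContDiff ℝ m χ := χ.contMDiff.contDiff
  have hχ0 (x : Fin n → ℝ) (hx : x ∉ V' ∩ Metric.ball 0 2) : ∀ᶠ y in 𝓝 x, χ y = 0 :=
    h0.filter_mono (nhds_le_nhdsSet hx)
  set G : (Fin n → ℝ) → ℝ := fun x => χ x * ((f x)⁻¹ - 1)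
  have hGz (x : Fin n → ℝ) (hx : x ∉ V' ∩ Metric.ball 0 2) : G x = 0 := by
    simp [G, (hχ0 x hx).self_of_nhds]
  have hG : ContDiff ℝ m G := contDiff_iff_contDiffAt.2 fun x => by
    by_cases hx : x ∈ V' ∩ Metric.ball 0 2
    · have hxV := hVV' hx.1
      exact hχd.contDiffAt.mul (((hf.contDiffAt (hV.mem_nhds hxV)).inv (hfpos x hxV).ne').sub
        contDiffAt_const)
    · refine (contDiffAt_const (c := (0 : ℝ))).congr_of_eventuallyEq ?_
      filter_upwards [hχ0 x hx] with y hy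
      simp [G, hy]
  have hlt (x : Fin n → ℝ) : -1 < G x := by
    by_cases hx : x ∈ V' ∩ Metric.ball 0 2
    · have hpos := inv_pos.2 (hfpos x (hVV' hx.1))
      simp only [G]
      rcases (hχ x).1.eq_or_lt with h | h
      · rw [← h]
        norm_num
      · nlinarith [(hχ x).2, mul_pos h hpos]
    · rw [hGz x hx]
      norm_num
  have hK : IsCompact (Metric.closedBall (0 : Fin n → ℝ) 2) := isCompact_closedBall _ _
  obtain ⟨x₀, -, hmin⟩ := hK.exists_isMinOn ⟨0, by simp⟩ hG.continuous.continuousOn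
  obtain ⟨C, hC⟩ := hK.exists_bound_of_continuousOn hG.continuous.continuousOn
  refine ⟨G, min 1 (1 + G x₀), max C 0, hG, lt_min one_pos (by linarith [hlt x₀]),
    min_le_left _ _, le_max_right _ _, fun x => ?_, fun x => ?_, fun x hx => ?_,
    fun x hx => hGz x fun h => hx h.1, fun x hx => by simp [G, hx]⟩
  · by_cases hx : x ∈ Metric.closedBall (0 : Fin n → ℝ) 2
    · have : G x₀ ≤ G x := hmin hx
      linarith [min_le_right 1 (1 + G x₀)]
    · rw [hGz x fun h => hx (Metric.ball_subset_closedBall h.2)]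
      linarith [min_le_left 1 (1 + G x₀)]
  · by_cases hx : x ∈ Metric.closedBall (0 : Fin n → ℝ) 2
    · exact (hC x hx).trans (le_max_left _ _)
    · rw [hGz x fun h => hx (Metric.ball_subset_closedBall h.2)]
      simp
  · simp [G, h1.self_of_nhdsSet x hx]

/-- **Grid lemma.**  Let `B = [-1,1]ⁿ` and let `f > 0` be `C^k` on a neighborhood of `B`,
equal to `1` at every point of `B` having at least two coordinates in `{-1,0,1}`.  Then
there is a `C^k` diffeomorphism `v` of `ℝⁿ` with `det(Dv) · (f ∘ v) = 1` on `∂'B` and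
`v = id` on `∂'B`; moreover, if `f ≡ 1` near `∂B`, then `v` may be chosen to be the
identity near `∂B`. -/
theorem grid_lemma (n k : ℕ) (hn : 2 ≤ n) (hk : 1 ≤ k)
    (f : (Fin n → ℝ) → ℝ) (V : Set (Fin n → ℝ)) (hV : IsOpen V)
    (hBV : Set.Icc (-1 : Fin n → ℝ) 1 ⊆ V)
    (hf : ContDiffOn ℝ (k : ℕ∞) f V) (hfpos : ∀ x ∈ V, 0 < f x)
    (hfaces : ∀ x : Fin n → ℝ, x ∈ Set.Icc (-1 : Fin n → ℝ) 1 →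
      (∃ i j : Fin n, i ≠ j ∧ (x i = -1 ∨ x i = 0 ∨ x i = 1) ∧
        (x j = -1 ∨ x j = 0 ∨ x j = 1)) → f x = 1) :
    (∃ v, GridSol n k f v) ∧
    ((∃ W : Set (Fin n → ℝ), IsOpen W ∧ frontier (Set.Icc (-1 : Fin n → ℝ) 1) ⊆ W ∧
        ∀ x ∈ W, f x = 1) →
      ∃ v, GridSol n k f v ∧
        ∃ W : Set (Fin n → ℝ), IsOpen W ∧ frontier (Set.Icc (-1 : Fin n → ℝ) 1) ⊆ W ∧
          ∀ x ∈ W, v x = x) := by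
  have hm : ((k : ℕ∞) : WithTop ℕ∞) ≠ 0 := by
    exact_mod_cast (show k ≠ 0 by omega)
  have main (V' : Set (Fin n → ℝ)) (hV' : IsOpen V') (hVV' : V' ⊆ V)
      (hBV' : Set.Icc (-1 : Fin n → ℝ) 1 ⊆ V') :
      ∃ v, GridSol n k f v ∧ ∀ W : Set (Fin n → ℝ), IsOpen W → (∀ x ∈ W, f x = 1) →
        (V' ⊆ {x | ∀ i, |x i| < 1} ∪ W) →
        ∃ W : Set (Fin n → ℝ), IsOpen W ∧ frontier (Set.Icc (-1 : Fin n → ℝ) 1) ⊆ W ∧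
          ∀ x ∈ W, v x = x := by
    obtain ⟨G, η, M, hG, hη, hη1, hM, hlow, hGM, hGf, hGV', hG1⟩ :=
      exists_density_extension hV hf hfpos hV' hVV' hBV'
    obtain ⟨v, hv, hinv, hdet, hfix, hnear⟩ := exists_diffeo_det_eq_one_add hm hG hη hη1 hM hlow
      hGM fun x hx hij => hG1 x (hfaces x hx hij)
    refine ⟨v, ⟨hv, hinv, fun x hx => ?_, hfix⟩, fun W hW hfW hsub => ?_⟩
    · have hB := (exists_of_mem_gridBdry hx).1
      rw [hdet x hx, hfix x hx, hGf x hB, add_sub_cancel, inv_mul_cancel₀ (hfpos x (hBV hB)).ne']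
    · refine hnear (W ∪ (Set.Icc (-1 : Fin n → ℝ) 1)ᶜ) (hW.union isClosed_Icc.isOpen_compl)
        (fun x ⟨i, hi⟩ => ?_) fun x hx => ?_
      · by_cases hB : x ∈ Set.Icc (-1 : Fin n → ℝ) 1
        · exact .inl ((hsub (hBV' hB)).resolve_left fun h => hi.not_gt (h i))
        · exact .inr hB
      · by_cases hxW : x ∈ W
        · exact hG1 x (hfW x hxW)
        · refine hGV' x fun h => hx.resolve_left hxW ?_
          have hlt := (hsub h).resolve_right hxW
          exact ⟨fun i => (abs_lt.1 (hlt i)).1.le, fun i => (abs_lt.1 (hlt i)).2.le⟩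
  constructor
  · obtain ⟨v, hv, -⟩ := main V hV Subset.rfl hBV
    exact ⟨v, hv⟩
  · rintro ⟨W, hW, hWB, hfW⟩
    have hO : IsOpen {x : Fin n → ℝ | ∀ i, |x i| < 1} := by
      rw [ofPred_forall]
      exact isOpen_iInter_of_finite fun i =>
        isOpen_lt (continuous_apply i).abs continuous_const
    obtain ⟨v, hv, hnear⟩ := main (V ∩ ({x | ∀ i, |x i| < 1} ∪ W)) (hV.inter (hO.union hW))
      inter_subset_left fun x hx => ⟨hBV hx, by
        by_cases h : ∀ i, |x i| < 1
        · exact .inl h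
        · exact .inr (hWB ⟨subset_closure hx, mt mem_interior_Icc_neg_one_one_iff.1 h⟩)⟩
    exact ⟨v, hv, hnear W hW hfW inter_subset_right⟩
end

section
/- Let n ≥ 2 and k ≥ 1 be integers, Q = [−1,1] × [0,1]^(n−1) ⊂ ℝⁿ, and let f : ℝⁿ → ℝ be a positive C^k function which equals 1 at every point of Q having at least two coordinates on the grid, i.e. f(x) = 1 whenever x ∈ Q and there exist indices i < j with x_i and x_j each lying in the allowed vertex set ({−1,0,1} for the first coordinate, {0,1} for the others). Define ∂'Q = ∂Q ∪ ({0} × [0,1]^(n−1)). Then there exists a C^k diffeomorphism v : ℝⁿ → ℝⁿ such that det(Dv(x)) · f(v(x)) = 1 for all x ∈ ∂'Q and v(x) = x for all x ∈ ∂'Q. Furthermore, if f ≡ 1 on a neighborhood of ∂Q, then v can be chosen so that v equals the identity on a neighborhood of ∂Q. -/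
open Set

/-- The double cube `Q = [-1,1] × [0,1]^m ⊂ ℝ × ℝ^m`. -/
def doubleCube (m : ℕ) : Set (ℝ × (Fin m → ℝ)) :=
  Set.Icc (-1 : ℝ) 1 ×ˢ Set.Icc (0 : Fin m → ℝ) 1

/-- `∂'Q`: the boundary of the double cube together with its middle face
`{0} × [0,1]^m`. -/
def doubleCubeBdry' (m : ℕ) : Set (ℝ × (Fin m → ℝ)) :=
  frontier (doubleCube m) ∪ ({0} : Set ℝ) ×ˢ Set.Icc (0 : Fin m → ℝ) 1

/-- The desired properties of the diffeomorphism `v` in the double-cube grid lemma. -/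
def DoubleGridSol (m k : ℕ) (f : ℝ × (Fin m → ℝ) → ℝ)
    (v : ℝ × (Fin m → ℝ) → ℝ × (Fin m → ℝ)) : Prop :=
  ContDiff ℝ (k : ℕ∞) v ∧
  (∃ w, ContDiff ℝ (k : ℕ∞) w ∧ Function.LeftInverse w v ∧ Function.RightInverse w v) ∧
  (∀ x ∈ doubleCubeBdry' m, LinearMap.det (fderiv ℝ v x).toLinearMap * f (v x) = 1) ∧
  (∀ x ∈ doubleCubeBdry' m, v x = x)

open scoped ContDiff Topology

/-- A `C^k` self-map of `E` with a `C^k` two-sided inverse. -/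
def IsContDiffDiffeo {E : Type*} [NormedAddCommGroup E] [NormedSpace ℝ E] (k : ℕ∞)
    (v : E → E) : Prop :=
  ContDiff ℝ k v ∧
    ∃ w, ContDiff ℝ k w ∧ Function.LeftInverse w v ∧ Function.RightInverse w v

/-- There is a smooth function, supported in `[-1/2, 1/2]`, with value `0` and slope `1` at the
origin, whose slopes lie within `ε` of `[0, 1]`. -/
theorem exists_smooth_bounded_slope {ε : ℝ} (hε : 0 < ε) :
    ∃ ψ : ℝ → ℝ, ContDiff ℝ ∞ ψ ∧ ψ 0 = 0 ∧ deriv ψ 0 = 1 ∧ (∀ t, 1 / 2 ≤ |t| → ψ t = 0) ∧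
      (∃ C, ∀ t, |ψ t| ≤ C) ∧ ∀ t, ∃ p ∈ Icc (0 : ℝ) 1, |deriv ψ t - p| ≤ ε := by
  let b : ContDiffBump (0 : ℝ) := ⟨1 / 4, 1 / 2, by norm_num, by norm_num⟩
  have hb : ContDiff ℝ ∞ b := b.contDiff
  obtain ⟨B, hB⟩ : ∃ B, ∀ t, ‖deriv b t‖ ≤ B :=
    b.hasCompactSupport.deriv.exists_bound_of_continuous (hb.continuous_deriv (by simp))
  have hB0 : 0 ≤ B := (norm_nonneg _).trans (hB 0)
  obtain ⟨δ, hδ, hδB⟩ : ∃ δ > 0, δ * 2 * B ≤ ε := by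
    refine ⟨ε / (2 * (B + 1)), by positivity, ?_⟩
    rw [show ε / (2 * (B + 1)) * 2 * B = ε * (B / (B + 1)) by field_simp]
    exact mul_le_of_le_one_right hε.le ((div_le_one (by positivity)).2 (by linarith))
  have harc : ∀ s, |Real.arctan s| ≤ 2 := fun s ↦ by
    rw [abs_le]
    constructor <;>
      linarith [Real.arctan_lt_pi_div_two s, Real.neg_pi_div_two_lt_arctan s, Real.pi_le_four]
  have hd : ∀ t, HasDerivAt (fun t ↦ δ * Real.arctan (t / δ) * b t)
      (1 / (1 + (t / δ) ^ 2) * b t + δ * Real.arctan (t / δ) * deriv b t) t := fun t ↦ by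
    have h1 := (((hasDerivAt_id t).div_const δ).arctan.const_mul δ).mul
      ((hb.differentiable (by simp) t).hasDerivAt)
    refine h1.congr_deriv ?_
    simp only [id]
    field_simp
  refine ⟨fun t ↦ δ * Real.arctan (t / δ) * b t, ?_, by simp, ?_, ?_, ⟨δ * 2, ?_⟩, ?_⟩
  · exact (contDiff_const.mul (Real.contDiff_arctan.comp (contDiff_id.div_const δ))).mul hb
  · rw [(hd 0).deriv]
    simp [b.one_of_mem_closedBall (Metric.mem_closedBall_self b.rIn_pos.le)]
  · intro t ht
    simp [b.zero_of_le_dist (x := t) (by simpa [b] using ht)]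
  · intro t
    rw [abs_mul, abs_mul, abs_of_pos hδ, abs_of_nonneg b.nonneg]
    exact (mul_le_of_le_one_right (by positivity) b.le_one).trans (by gcongr; exact harc _)
  · intro t
    refine ⟨1 / (1 + (t / δ) ^ 2) * b t, ⟨mul_nonneg (by positivity) b.nonneg, ?_⟩, ?_⟩
    · refine mul_le_one₀ ((div_le_one (by positivity)).2 ?_) b.nonneg b.le_one
      nlinarith [sq_nonneg (t / δ)]
    · rw [(hd t).deriv, add_sub_cancel_left, abs_mul, abs_mul, abs_of_pos hδ]
      refine le_trans ?_ hδB
      gcongr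
      exacts [harc _, hB t]

section Diffeo

variable {E : Type*} [NormedAddCommGroup E] [NormedSpace ℝ E]

theorem isContDiffDiffeo_id (k : ℕ∞) : IsContDiffDiffeo k (id : E → E) :=
  ⟨contDiff_id, id, contDiff_id, fun _ ↦ rfl, fun _ ↦ rfl⟩

theorem IsContDiffDiffeo.comp {k : ℕ∞} {u v : E → E} (hu : IsContDiffDiffeo k u)
    (hv : IsContDiffDiffeo k v) : IsContDiffDiffeo k (u ∘ v) := by
  obtain ⟨hu, u', hu', hul, hur⟩ := hu
  obtain ⟨hv, v', hv', hvl, hvr⟩ := hv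
  exact ⟨hu.comp hv, v' ∘ u', hv'.comp hu', hul.comp hvl, hur.comp hvr⟩

/-- Global inverse function theorem for bijections. -/
theorem ContDiff.isContDiffDiffeo [FiniteDimensional ℝ E] {k : ℕ∞} (hk : 1 ≤ k) {v : E → E}
    (hv : ContDiff ℝ k v) (hbij : Function.Bijective v)
    (hdet : ∀ x, LinearMap.det (fderiv ℝ v x).toLinearMap ≠ 0) : IsContDiffDiffeo k v := by
  have : CompleteSpace E := FiniteDimensional.complete ℝ E
  have hk' : ((k : ℕ∞) : WithTop ℕ∞) ≠ 0 := by
    exact_mod_cast (zero_lt_one.trans_le hk).ne'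
  let A : E → E ≃L[ℝ] E := fun x ↦
    (fderiv ℝ v x).toContinuousLinearEquivOfDetNeZero (hdet x)
  have hs : ∀ x, HasStrictFDerivAt v (A x : E →L[ℝ] E) x := fun x ↦ by
    simpa [A] using hv.contDiffAt.hasStrictFDerivAt (x := x) hk'
  let H : E ≃ₜ E := (Equiv.ofBijective v hbij).toHomeomorphOfContinuousOpen hv.continuous
    (isOpenMap_of_hasStrictFDerivAt_equiv hs)
  exact ⟨hv, H.symm, H.contDiff_symm (f₀' := A) (fun x ↦ (hs x).hasFDerivAt) hv,
    H.symm_apply_apply, H.apply_symm_apply⟩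

/-- A finite family of diffeomorphisms fixing `s` pointwise can be composed, in some order, so that
the Jacobian determinants multiply on `s`. -/
theorem exists_isContDiffDiffeo_det_eq_prod {ι : Type*} {k : ℕ∞} (hk : 1 ≤ k) (s : Set E)
    (T : Finset ι) (S : ι → E → E) (hS : ∀ i ∈ T, IsContDiffDiffeo k (S i))
    (hfix : ∀ i ∈ T, ∀ x ∈ s, S i x = x) :
    ∃ v, IsContDiffDiffeo k v ∧ (∀ x ∈ s, v x = x) ∧ ∀ x ∈ s,
      LinearMap.det (fderiv ℝ v x).toLinearMap =
        ∏ i ∈ T, LinearMap.det (fderiv ℝ (S i) x).toLinearMap := by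
  classical
  have hk' : ((k : ℕ∞) : WithTop ℕ∞) ≠ 0 := by
    exact_mod_cast (zero_lt_one.trans_le hk).ne'
  induction T using Finset.induction_on with
  | empty => exact ⟨id, isContDiffDiffeo_id k, fun _ _ ↦ rfl, fun x _ ↦ by simp⟩
  | insert i T hi ih =>
    obtain ⟨v, hv, hvs, hvd⟩ := ih (fun j hj ↦ hS j (Finset.mem_insert_of_mem hj))
      (fun j hj ↦ hfix j (Finset.mem_insert_of_mem hj))
    have hSi := hS i (Finset.mem_insert_self i T)
    have hfi := hfix i (Finset.mem_insert_self i T)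
    refine ⟨S i ∘ v, hSi.comp hv, fun x hx ↦ by simp [hvs x hx, hfi x hx], fun x hx ↦ ?_⟩
    rw [Finset.prod_insert hi, ← hvd x hx,
      fderiv_comp x (hSi.1.differentiable hk' _) (hv.1.differentiable hk' _), hvs x hx,
      ContinuousLinearMap.toLinearMap_comp, LinearMap.det_comp]

/-- Stretching by `1 + F` across the hyperplane `ℓ = a`, in the direction `e`. -/
theorem exists_stretch [FiniteDimensional ℝ E] {k : ℕ∞} (hk : 1 ≤ k) (ℓ : E →L[ℝ] ℝ) (e : E)
    (he : ℓ e = 1) {F : E → ℝ} (hF : ContDiff ℝ k F) (hFc : HasCompactSupport F)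
    (hF1 : ∀ x, -1 < F x) (a : ℝ) :
    ∃ S : E → E, IsContDiffDiffeo k S ∧
      (∀ x, ℓ x = a → S x = x ∧ LinearMap.det (fderiv ℝ S x).toLinearMap = 1 + F x) ∧
      (∀ x, 1 / 2 < |ℓ x - a| → S x = x ∧ LinearMap.det (fderiv ℝ S x).toLinearMap = 1) ∧
      (∀ x, F (x - (ℓ x - a) • e) = 0 →
        S x = x ∧ LinearMap.det (fderiv ℝ S x).toLinearMap = 1) := by
  have hk' : ((k : ℕ∞) : WithTop ℕ∞) ≠ 0 := by
    exact_mod_cast (zero_lt_one.trans_le hk).ne'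
  obtain ⟨x₀, hx₀⟩ := hF.continuous.exists_forall_le_of_hasCompactSupport hFc
  obtain ⟨M, hM⟩ := hFc.exists_bound_of_continuous hF.continuous
  have hM0 : 0 ≤ M := (norm_nonneg _).trans (hM x₀)
  obtain ⟨μ, hμ, hμ1, hμF⟩ : ∃ μ > 0, μ ≤ 1 ∧ ∀ x, μ ≤ 1 + F x :=
    ⟨min 1 (1 + F x₀), lt_min one_pos (by linarith [hF1 x₀]), min_le_left _ _,
      fun x ↦ (min_le_right _ _).trans (by linarith [hx₀ x])⟩
  obtain ⟨ψ, hψ, hψ0, hψ1, hψs, ⟨C, hC⟩, hψd⟩ :=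
    exists_smooth_bounded_slope (ε := μ / (2 * (M + 1))) (by positivity)
  have hψdiff : Differentiable ℝ ψ := hψ.differentiable (by simp)
  have hpos : ∀ t x, 0 < 1 + deriv ψ t * F x := fun t x ↦ by
    obtain ⟨p, ⟨hp0, hp1⟩, hp⟩ := hψd t
    have h1 : |(deriv ψ t - p) * F x| ≤ μ / 2 := by
      rw [abs_mul]
      calc |deriv ψ t - p| * |F x| ≤ μ / (2 * (M + 1)) * (M + 1) := by
            gcongr
            exact (hM x).trans (by linarith)
        _ = μ / 2 := by field_simp
    have h2 : μ ≤ 1 + p * F x := by nlinarith [hμF x]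
    nlinarith [(abs_le.1 h1).1]
  let P : E → E := fun x ↦ x - (ℓ x - a) • e
  have hPsmooth : ContDiff ℝ k P :=
    contDiff_id.sub ((ℓ.contDiff.sub contDiff_const).smul contDiff_const)
  have hPadd : ∀ x (c : ℝ), P (x + c • e) = P x := fun x c ↦ by
    simp only [P, map_add, map_smul, he, smul_eq_mul, mul_one]
    module
  let S : E → E := fun x ↦ x + (ψ (ℓ x - a) * F (P x)) • e
  have hPS : ∀ x, P (S x) = P x := fun x ↦ hPadd _ _
  have hℓS : ∀ x, ℓ (S x) = ℓ x + ψ (ℓ x - a) * F (P x) := fun x ↦ by simp [S, he]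
  have hg : ContDiff ℝ k (fun x ↦ ψ (ℓ x - a) * F (P x)) :=
    ((hψ.of_le (by exact_mod_cast le_top)).comp (ℓ.contDiff.sub contDiff_const)).mul
      (hF.comp hPsmooth)
  have hS : ContDiff ℝ k S := contDiff_id.add (hg.smul contDiff_const)
  have hdet : ∀ x, LinearMap.det (fderiv ℝ S x).toLinearMap =
      1 + deriv ψ (ℓ x - a) * F (P x) := fun x ↦ by
    have hgd := (hg.differentiable hk' x).hasFDerivAt
    have h1 : HasFDerivAt S _ x := (hasFDerivAt_id x).add (hgd.smul_const e)
    have h2 : (fderiv ℝ S x).toLinearMap = LinearMap.transvection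
        (fderiv ℝ (fun x ↦ ψ (ℓ x - a) * F (P x)) x).toLinearMap e := by
      rw [h1.fderiv]
      ext y
      simp [LinearMap.transvection]
    rw [h2, LinearMap.transvection.det]
    congr 1
    have hline : HasDerivAt (fun c : ℝ ↦ x + c • e) e 0 := by
      simpa using ((hasDerivAt_id (0 : ℝ)).smul_const e).const_add x
    have h3 := HasFDerivAt.comp_hasDerivAt (0 : ℝ) (by simpa using hgd) hline
    refine h3.unique ?_
    have h4 : HasDerivAt ψ (deriv ψ (ℓ x - a)) (ℓ x - a + 0) := by
      rw [add_zero]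
      exact (hψdiff _).hasDerivAt
    have h5 : (fun x ↦ ψ (ℓ x - a) * F (P x)) ∘ (fun c : ℝ ↦ x + c • e) =
        fun c ↦ ψ (ℓ x - a + c) * F (P x) := by
      funext c
      simp only [Function.comp, hPadd, map_add, map_smul, he, smul_eq_mul, mul_one]
      rw [add_sub_right_comm]
    rw [h5]
    exact (h4.comp_const_add (ℓ x - a) 0).mul_const (F (P x))
  have hline : ∀ x, StrictMono (fun t : ℝ ↦ t + ψ (t - a) * F x) := fun x ↦ by
    refine strictMono_of_deriv_pos fun t ↦ ?_
    have : HasDerivAt (fun t : ℝ ↦ t + ψ (t - a) * F x) (1 + deriv ψ (t - a) * F x) t :=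
      (hasDerivAt_id t).add
        (((hψdiff (t - a)).hasDerivAt.comp_sub_const t a).mul_const (F x))
    rw [this.deriv]
    exact hpos _ _
  have hsurj : ∀ x, Function.Surjective (fun t : ℝ ↦ t + ψ (t - a) * F x) := fun x ↦ by
    have hb : ∀ t, |ψ (t - a) * F x| ≤ C * |F x| := fun t ↦ by
      rw [abs_mul]
      gcongr
      exact hC _
    refine Continuous.surjective ?_ ?_ ?_
    · exact continuous_id.add ((hψ.continuous.comp (continuous_id.sub continuous_const)).mul_const _)
    · exact Filter.tendsto_atTop_add_right_of_le _ (-(C * |F x|)) Filter.tendsto_id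
        fun t ↦ (abs_le.1 (hb t)).1
    · exact Filter.tendsto_atBot_add_right_of_ge _ (C * |F x|) Filter.tendsto_id
        fun t ↦ (abs_le.1 (hb t)).2
  have hbij : Function.Bijective S := by
    constructor
    · intro x y hxy
      have hP : P x = P y := by rw [← hPS x, hxy, hPS]
      have hℓ : ℓ x = ℓ y := (hline (P x)).injective (by
        simpa only [hℓS, ← hP] using congrArg ℓ hxy)
      simpa [P, hℓ] using hP
    · intro y
      obtain ⟨t, ht⟩ := hsurj (P y) (ℓ y)
      have h1 : ℓ (y + (t - ℓ y) • e) = t := by simp [he]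
      refine ⟨y + (t - ℓ y) • e, ?_⟩
      simp only [S, hPadd, h1]
      rw [add_assoc, ← add_smul, show t - ℓ y + ψ (t - a) * F (P y) = 0 by simp at ht; linarith,
        zero_smul, add_zero]
  refine ⟨S, hS.isContDiffDiffeo hk hbij fun x ↦ by rw [hdet]; exact (hpos _ _).ne',
    fun x hx ↦ ⟨by simp [S, hx, hψ0], by rw [hdet]; simp [P, hx, hψ1]⟩, fun x hx ↦ ⟨?_, ?_⟩,
    fun x hx ↦ ⟨by simp [S, P, hx], by rw [hdet]; simp [P, hx]⟩⟩
  · simp [S, hψs _ hx.le]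
  · have : ψ =ᶠ[𝓝 (ℓ x - a)] fun _ ↦ 0 := by
      filter_upwards [(isOpen_lt continuous_const continuous_abs).mem_nhds hx] with t ht
      exact hψs t (le_of_lt ht)
    rw [hdet, this.deriv_eq]
    simp

end Diffeo

section Grid

variable {m : ℕ}

/-- The coordinates of `ℝ × ℝ^m`, indexed by `Option (Fin m)`. -/
def gridCoord (o : Option (Fin m)) : ℝ × (Fin m → ℝ) →L[ℝ] ℝ :=
  o.elim (.fst ℝ ℝ (Fin m → ℝ)) fun j ↦
    (ContinuousLinearMap.proj (R := ℝ) (φ := fun _ : Fin m ↦ ℝ) j).comp (.snd ℝ ℝ (Fin m → ℝ))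

/-- The standard basis of `ℝ × ℝ^m`, indexed by `Option (Fin m)`. -/
def gridDir (o : Option (Fin m)) : ℝ × (Fin m → ℝ) :=
  o.elim (1, 0) fun j ↦ (0, Pi.single j 1)

/-- The vertex coordinates of the double cube in a given direction. -/
noncomputable def gridVertices (o : Option (Fin m)) : Finset ℝ :=
  o.elim {-1, 0, 1} fun _ ↦ {0, 1}

theorem gridCoord_gridDir_self (o : Option (Fin m)) : gridCoord o (gridDir o) = 1 := by
  cases o <;> simp [gridCoord, gridDir]

theorem gridCoord_gridDir_of_ne {o o' : Option (Fin m)} (h : o ≠ o') :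
    gridCoord o (gridDir o') = 0 := by
  cases o <;> cases o' <;> simp_all [gridCoord, gridDir]

theorem mem_doubleCube_iff {x : ℝ × (Fin m → ℝ)} :
    x ∈ doubleCube m ↔ ∀ o, gridCoord o x ∈ Icc (o.elim (-1) fun _ ↦ 0 : ℝ) 1 := by
  simp [doubleCube, gridCoord, Option.forall, Prod.le_def, Pi.le_def, forall_and]

theorem mem_Icc_of_mem_gridVertices {o : Option (Fin m)} {a : ℝ} (ha : a ∈ gridVertices o) :
    a ∈ Icc (o.elim (-1) fun _ ↦ 0 : ℝ) 1 := by
  cases o <;> simp [gridVertices] at ha <;> rcases ha with rfl | rfl | rfl <;> norm_num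

theorem half_lt_abs_sub_of_mem_gridVertices {o : Option (Fin m)} {a b : ℝ}
    (ha : a ∈ gridVertices o) (hb : b ∈ gridVertices o) (hab : a ≠ b) : 1 / 2 < |a - b| := by
  cases o <;> simp [gridVertices] at ha hb <;> rcases ha with rfl | rfl | rfl <;>
    rcases hb with rfl | rfl | rfl <;> first | exact absurd rfl hab | norm_num [abs_of_pos]

theorem gridCoord_proj_self (o : Option (Fin m)) (a : ℝ) (x : ℝ × (Fin m → ℝ)) :
    gridCoord o (x - (gridCoord o x - a) • gridDir o) = a := by
  simp [gridCoord_gridDir_self]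

theorem gridCoord_proj_of_ne {o o' : Option (Fin m)} (h : o' ≠ o) (a : ℝ)
    (x : ℝ × (Fin m → ℝ)) :
    gridCoord o' (x - (gridCoord o x - a) • gridDir o) = gridCoord o' x := by
  simp [gridCoord_gridDir_of_ne h]

theorem proj_mem_doubleCube {o : Option (Fin m)} {a : ℝ} (ha : a ∈ gridVertices o)
    {x : ℝ × (Fin m → ℝ)} (hx : x ∈ doubleCube m) :
    x - (gridCoord o x - a) • gridDir o ∈ doubleCube m := by
  rw [mem_doubleCube_iff] at hx ⊢
  intro o'
  rcases eq_or_ne o' o with rfl | h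
  · rw [gridCoord_proj_self]
    exact mem_Icc_of_mem_gridVertices ha
  · rw [gridCoord_proj_of_ne h]
    exact hx o'

theorem doubleCube_subset_closedBall (m : ℕ) :
    doubleCube m ⊆ Metric.closedBall (0 : ℝ × (Fin m → ℝ)) 2 := by
  rintro ⟨s, y⟩ ⟨⟨h1, h2⟩, h3, h4⟩
  rw [mem_closedBall_zero_iff, Prod.norm_def, max_le_iff, Real.norm_eq_abs, abs_le,
    pi_norm_le_iff_of_nonneg zero_le_two]
  refine ⟨⟨by dsimp at *; linarith, by dsimp at *; linarith⟩, fun j ↦ ?_⟩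
  have := h3 j
  have := h4 j
  rw [Real.norm_eq_abs, abs_le]
  constructor <;> dsimp at * <;> linarith

theorem mem_frontier_doubleCube_iff {x : ℝ × (Fin m → ℝ)} :
    x ∈ frontier (doubleCube m) ↔ x ∈ doubleCube m ∧
      (x.1 = -1 ∨ x.1 = 1 ∨ ∃ j, x.2 j = 0 ∨ x.2 j = 1) := by
  have hcl : IsClosed (doubleCube m) := isClosed_Icc.prod isClosed_Icc
  have hint : interior (doubleCube m) = Ioo (-1) 1 ×ˢ univ.pi fun _ ↦ Ioo 0 1 := by
    rw [doubleCube, interior_prod_eq, interior_Icc, ← pi_univ_Icc, interior_pi_set finite_univ]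
    simp
  rw [hcl.frontier_eq, hint, mem_sdiff]
  refine and_congr_right fun hx ↦ ?_
  obtain ⟨⟨h1, h2⟩, h3, h4⟩ := hx
  have h3' : ∀ j, 0 ≤ x.2 j := h3
  have h4' : ∀ j, x.2 j ≤ 1 := h4
  simp only [mem_prod, mem_Ioo, mem_pi, mem_univ, true_imp_iff]
  constructor
  · intro h
    contrapose! h
    exact ⟨⟨h1.lt_of_ne' h.1, h2.lt_of_ne h.2.1⟩,
      fun j ↦ ⟨(h3' j).lt_of_ne' (h.2.2 j).1, (h4' j).lt_of_ne (h.2.2 j).2⟩⟩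
  · rintro (h | h | ⟨j, h | h⟩) ⟨⟨h5, h6⟩, h7⟩
    · exact h5.ne' h
    · exact h6.ne h
    · exact (h7 j).1.ne' h
    · exact (h7 j).2.ne h

theorem mem_doubleCube_of_mem_bdry {x : ℝ × (Fin m → ℝ)} (hx : x ∈ doubleCubeBdry' m) :
    x ∈ doubleCube m ∧ ∃ o, gridCoord o x ∈ gridVertices o := by
  rcases hx with hx | ⟨h1, h2⟩
  · obtain ⟨hQ, h | h | ⟨j, h⟩⟩ := mem_frontier_doubleCube_iff.1 hx
    · exact ⟨hQ, none, by simp [gridCoord, gridVertices, h]⟩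
    · exact ⟨hQ, none, by simp [gridCoord, gridVertices, h]⟩
    · exact ⟨hQ, some j, by simpa [gridCoord, gridVertices] using h⟩
  · rw [mem_singleton_iff] at h1
    exact ⟨⟨by rw [h1]; norm_num, h2⟩, none, by simp [gridCoord, gridVertices, h1]⟩

end Grid

/-- **Grid lemma for the double cube** `Q = [-1,1] × [0,1]^(n-1)` (here `n = m + 1`,
`m ≥ 1`).  If `f > 0` is `C^k` on `ℝⁿ` and equals `1` at every point of `Q` having at
least two coordinates on the grid (`{-1,0,1}` for the first coordinate, `{0,1}` for the
others), then there is a `C^k` diffeomorphism `v` of `ℝⁿ` with `det(Dv) · (f ∘ v) = 1`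
on `∂'Q` and `v = id` on `∂'Q`; moreover, if `f ≡ 1` near `∂Q`, then `v` may be chosen
to be the identity near `∂Q`. -/
theorem double_cube_grid (m k : ℕ) (hm : 1 ≤ m) (hk : 1 ≤ k)
    (f : ℝ × (Fin m → ℝ) → ℝ) (hf : ContDiff ℝ (k : ℕ∞) f) (hfpos : ∀ x, 0 < f x)
    (hfaces : ∀ x : ℝ × (Fin m → ℝ), x ∈ doubleCube m →
      (((x.1 = -1 ∨ x.1 = 0 ∨ x.1 = 1) ∧ ∃ j, (x.2 j = 0 ∨ x.2 j = 1)) ∨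
        (∃ j j' : Fin m, j ≠ j' ∧ (x.2 j = 0 ∨ x.2 j = 1) ∧ (x.2 j' = 0 ∨ x.2 j' = 1))) →
      f x = 1) :
    (∃ v, DoubleGridSol m k f v) ∧
    ((∃ W : Set (ℝ × (Fin m → ℝ)), IsOpen W ∧ frontier (doubleCube m) ⊆ W ∧
        ∀ x ∈ W, f x = 1) →
      ∃ v, DoubleGridSol m k f v ∧
        ∃ W : Set (ℝ × (Fin m → ℝ)), IsOpen W ∧ frontier (doubleCube m) ⊆ W ∧
          ∀ x ∈ W, v x = x) := by
  have hk1 : (1 : ℕ∞) ≤ (k : ℕ∞) := by exact_mod_cast hk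
  have hfaces' : ∀ x ∈ doubleCube m, ∀ o o', o ≠ o' → gridCoord o x ∈ gridVertices o →
      gridCoord o' x ∈ gridVertices o' → f x = 1 := by
    intro x hx o o' hne ho ho'
    refine hfaces x hx ?_
    cases o <;> cases o' <;> simp [gridCoord, gridVertices] at hne ho ho'
    · exact Or.inl ⟨ho, _, ho'⟩
    · exact Or.inl ⟨ho', _, ho⟩
    · exact Or.inr ⟨_, _, hne, ho, ho'⟩
  let χ : ContDiffBump (0 : ℝ × (Fin m → ℝ)) := ⟨2, 3, by norm_num, by norm_num⟩
  let F : ℝ × (Fin m → ℝ) → ℝ := fun x ↦ χ x * ((f x)⁻¹ - 1)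
  have hF : ContDiff ℝ (k : ℕ∞) F :=
    χ.contDiff.mul ((hf.inv fun x ↦ (hfpos x).ne').sub contDiff_const)
  have hFc : HasCompactSupport F := χ.hasCompactSupport.mul_right
  have hF1 : ∀ x, -1 < F x := fun x ↦ by
    have h1 : 0 < (f x)⁻¹ := inv_pos.2 (hfpos x)
    have h2 : 0 ≤ χ x := χ.nonneg
    have h3 : χ x ≤ 1 := χ.le_one
    rcases h3.lt_or_eq with h | h
    · change -1 < χ x * ((f x)⁻¹ - 1)
      nlinarith
    · simp only [F, h]
      linarith
  have hF0 : ∀ x, f x = 1 → F x = 0 := fun x hx ↦ by simp [F, hx]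
  have hFQ : ∀ x ∈ doubleCube m, 1 + F x = (f x)⁻¹ := fun x hx ↦ by
    have : χ x = 1 := χ.one_of_mem_closedBall (doubleCube_subset_closedBall m hx)
    simp [F, this]
  choose S hSd hSon hSoff hSF using fun p : Option (Fin m) × ℝ ↦
    exists_stretch hk1 (gridCoord p.1) (gridDir p.1) (gridCoord_gridDir_self p.1) hF hFc hF1 p.2
  have hother : ∀ o, ∀ a ∈ gridVertices o, ∀ x ∈ doubleCube m, ∀ o',
      gridCoord o' x ∈ gridVertices o' → (o, a) ≠ (o', gridCoord o' x) →
      S (o, a) x = x ∧ LinearMap.det (fderiv ℝ (S (o, a)) x).toLinearMap = 1 := by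
    intro o a ha x hx o' ho' hne
    rcases eq_or_ne o' o with rfl | h
    · exact hSoff (o', a) x (half_lt_abs_sub_of_mem_gridVertices ho' ha fun h ↦ hne (by rw [h]))
    · refine hSF (o, a) x (hF0 _ (hfaces' _ (proj_mem_doubleCube ha hx) o' o h ?_ ?_))
      · rwa [gridCoord_proj_of_ne h]
      · rwa [gridCoord_proj_self]
  have hfix : ∀ o, ∀ a ∈ gridVertices o, ∀ x ∈ doubleCubeBdry' m, S (o, a) x = x := by
    intro o a ha x hx
    obtain ⟨hxQ, o', ho'⟩ := mem_doubleCube_of_mem_bdry hx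
    by_cases h : (o, a) = (o', gridCoord o' x)
    · obtain ⟨rfl, rfl⟩ := Prod.mk.inj h
      exact (hSon (o, gridCoord o x) x rfl).1
    · exact (hother o a ha x hxQ o' ho' h).1
  constructor
  · let T : Finset (Option (Fin m) × ℝ) :=
      Finset.univ.biUnion fun o ↦ (gridVertices o).map ⟨Prod.mk o, Prod.mk_right_injective o⟩
    have hT : ∀ p, p ∈ T ↔ p.2 ∈ gridVertices p.1 := by
      rintro ⟨o, a⟩
      simp [T]
    obtain ⟨v, hv, hvfix, hvdet⟩ := exists_isContDiffDiffeo_det_eq_prod hk1 (doubleCubeBdry' m) T S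
      (fun p _ ↦ hSd p) fun p hp ↦ hfix p.1 p.2 ((hT p).1 hp)
    refine ⟨v, hv.1, hv.2, fun x hx ↦ ?_, hvfix⟩
    obtain ⟨hxQ, o, ho⟩ := mem_doubleCube_of_mem_bdry hx
    rw [hvfix x hx, hvdet x hx, Finset.prod_eq_single (o, gridCoord o x),
      (hSon (o, gridCoord o x) x rfl).2, hFQ x hxQ, inv_mul_cancel₀ (hfpos x).ne']
    · rintro ⟨o', a⟩ hp hne
      exact (hother o' a ((hT _).1 hp) x hxQ o ho hne).2
    · exact fun h ↦ absurd ((hT _).2 ho) h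
  · rintro ⟨W, hWo, hW, hfW⟩
    have h0 : (0 : ℝ) ∈ gridVertices (none : Option (Fin m)) := by simp [gridVertices]
    refine ⟨S (none, 0), ⟨(hSd _).1, (hSd _).2, fun x hx ↦ ?_, hfix none 0 h0⟩, ?_⟩
    · obtain ⟨hxQ, o, ho⟩ := mem_doubleCube_of_mem_bdry hx
      rw [hfix none 0 h0 x hx]
      by_cases hx0 : gridCoord none x = 0
      · rw [(hSon (none, 0) x hx0).2, hFQ x hxQ, inv_mul_cancel₀ (hfpos x).ne']
      · have hxW : x ∈ W := hW (hx.resolve_right fun h ↦ hx0 h.1)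
        rw [hfW x hxW, mul_one]
        refine (hother none 0 h0 x hxQ o ho fun h ↦ hx0 ?_).2
        obtain ⟨rfl, h⟩ := Prod.mk.inj h
        exact h.symm
    · refine ⟨{x | 1 / 2 < |x.1|} ∪ {x | ((0 : ℝ), x.2) ∈ W}, ?_, ?_, ?_⟩
      · exact (isOpen_lt continuous_const (continuous_abs.comp continuous_fst)).union
          (hWo.preimage (by fun_prop))
      · intro x hx
        obtain ⟨hxQ, h | h | h⟩ := mem_frontier_doubleCube_iff.1 hx
        · left
          norm_num [h]
        · left
          norm_num [h]
        · right
          exact hW (mem_frontier_doubleCube_iff.2 ⟨⟨by norm_num, hxQ.2⟩, Or.inr (Or.inr h)⟩)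
      · rintro x (hx | hx)
        · exact (hSoff (none, 0) x (by simpa [gridCoord] using hx)).1
        · refine (hSF (none, 0) x (hF0 _ (hfW _ ?_))).1
          convert (show ((0 : ℝ), x.2) ∈ W from hx) using 1
          ext <;> simp [gridCoord, gridDir]
end

section
/- There exists a C^∞ function β : (0,∞) × (0,∞) × ℝ → (0,∞) such that for all a, b > 0: (i) β(a, b, x) = a for all x in some neighborhood of 0 (and for all x ≤ 0), (ii) β(a, b, x) = b for all x in some neighborhood of 1 (and for all x ≥ 1), (iii) β(1, 1, x) = 1 for all x ∈ ℝ, and (iv) ∫₀¹ β(a, b, x) dx = 1. -/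
open Set

/-- A smooth cutoff, equal to `1` on `(-∞, 1/2]` and to `0` on `[1, ∞)`. -/
noncomputable def cutoff (t : ℝ) : ℝ := 1 - Real.smoothTransition (2 * t - 1)

theorem cutoff_contDiff : ContDiff ℝ (⊤ : ℕ∞) cutoff :=
  contDiff_const.sub (Real.smoothTransition.contDiff.comp
    ((contDiff_const.mul contDiff_id).sub contDiff_const))

theorem cutoff_nonneg (t : ℝ) : 0 ≤ cutoff t :=
  sub_nonneg.2 (Real.smoothTransition.le_one _)

theorem cutoff_le_one (t : ℝ) : cutoff t ≤ 1 :=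
  sub_le_self _ (Real.smoothTransition.nonneg _)

theorem cutoff_eq_one {t : ℝ} (h : t ≤ 1 / 2) : cutoff t = 1 := by
  rw [cutoff, Real.smoothTransition.zero_of_nonpos (by linarith), sub_zero]

theorem cutoff_eq_zero {t : ℝ} (h : 1 ≤ t) : cutoff t = 0 := by
  rw [cutoff, Real.smoothTransition.one_of_one_le (by linarith), sub_self]

theorem cutoff_intervalIntegrable (s t : ℝ) :
    IntervalIntegrable cutoff MeasureTheory.volume s t :=
  cutoff_contDiff.continuous.intervalIntegrable s t

/-- The mass of `cutoff` on `[0, 1]`. -/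
noncomputable def cutoffMass : ℝ := ∫ t in (0 : ℝ)..1, cutoff t

theorem cutoffMass_le_one : cutoffMass ≤ 1 := by
  have h := intervalIntegral.integral_mono_on (zero_le_one' ℝ)
    (cutoff_intervalIntegrable 0 1) (intervalIntegrable_const (c := (1 : ℝ)))
    (fun t _ => cutoff_le_one t)
  simpa [cutoffMass] using h

theorem integral_cutoff_mul {M : ℝ} (hM : 1 ≤ M) :
    ∫ x in (0 : ℝ)..1, cutoff (M * x) = cutoffMass / M := by
  have htail : ∫ x in (1 : ℝ)..M, cutoff x = 0 := by
    rw [intervalIntegral.integral_congr (g := fun _ => (0 : ℝ))]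
    · simp
    · intro x hx
      rw [uIcc_of_le hM] at hx
      exact cutoff_eq_zero hx.1
  rw [intervalIntegral.integral_comp_mul_left _ (by linarith : M ≠ 0), mul_zero, mul_one,
    ← intervalIntegral.integral_add_adjacent_intervals (cutoff_intervalIntegrable 0 1)
      (cutoff_intervalIntegrable 1 M), htail, add_zero, smul_eq_mul, cutoffMass, div_eq_inv_mul]

theorem integral_cutoff_mul_one_sub {M : ℝ} (hM : 1 ≤ M) :
    ∫ x in (0 : ℝ)..1, cutoff (M * (1 - x)) = cutoffMass / M := by
  rw [intervalIntegral.integral_comp_sub_left (fun x => cutoff (M * x)), sub_self, sub_zero,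
    integral_cutoff_mul hM]

/-- The value in the middle of `[0, 1]` that normalizes the integral of `bumpInterp a b`. -/
noncomputable def bumpLevel (a b : ℝ) : ℝ :=
  (2 + a + b - cutoffMass * (a + b)) / (2 + a + b - 2 * cutoffMass)

theorem bumpLevel_pos {a b : ℝ} (ha : 0 < a) (hb : 0 < b) : 0 < bumpLevel a b := by
  have h := cutoffMass_le_one
  apply div_pos <;> nlinarith

/-- The function equal to `a` near `0`, to `b` near `1` and to `bumpLevel a b` in between, with
transitions of width comparable to `(2 + a + b)⁻¹`. -/
noncomputable def bumpInterp (a b x : ℝ) : ℝ :=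
  a * cutoff ((2 + a + b) * x) + b * cutoff ((2 + a + b) * (1 - x)) +
    bumpLevel a b * (1 - cutoff ((2 + a + b) * x) - cutoff ((2 + a + b) * (1 - x)))

theorem bumpInterp_contDiffOn :
    ContDiffOn ℝ (⊤ : ℕ∞) (fun p : ℝ × ℝ × ℝ => bumpInterp p.1 p.2.1 p.2.2)
      (Ioi (0 : ℝ) ×ˢ Ioi (0 : ℝ) ×ˢ (univ : Set ℝ)) := by
  have hleft : ContDiff ℝ (⊤ : ℕ∞)
      (fun p : ℝ × ℝ × ℝ => cutoff ((2 + p.1 + p.2.1) * p.2.2)) :=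
    cutoff_contDiff.comp (by fun_prop)
  have hright : ContDiff ℝ (⊤ : ℕ∞)
      (fun p : ℝ × ℝ × ℝ => cutoff ((2 + p.1 + p.2.1) * (1 - p.2.2))) :=
    cutoff_contDiff.comp (by fun_prop)
  have hlevel : ContDiffOn ℝ (⊤ : ℕ∞) (fun p : ℝ × ℝ × ℝ => bumpLevel p.1 p.2.1)
      (Ioi (0 : ℝ) ×ˢ Ioi (0 : ℝ) ×ˢ (univ : Set ℝ)) := by
    refine ContDiffOn.div (by fun_prop) (by fun_prop) ?_
    rintro ⟨a, b, x⟩ ⟨ha, hb, -⟩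
    have ha' : 0 < a := ha
    have hb' : 0 < b := hb
    have h := cutoffMass_le_one
    exact ne_of_gt (by linarith)
  exact (((contDiff_fst.mul hleft).add
    ((contDiff_fst.comp contDiff_snd).mul hright)).contDiffOn).add
      (hlevel.mul ((contDiff_const.sub hleft).sub hright).contDiffOn)

theorem bumpInterp_pos {a b : ℝ} (ha : 0 < a) (hb : 0 < b) (x : ℝ) : 0 < bumpInterp a b x := by
  have hc := bumpLevel_pos ha hb
  have pos_of_mix {u v t : ℝ} (hu : 0 < u) (hv : 0 < v) (ht₀ : 0 ≤ t) (ht₁ : t ≤ 1) :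
      0 < u * t + v * (1 - t) := by
    rcases ht₀.eq_or_lt with rfl | ht
    · simpa using hv
    · have := mul_pos hu ht
      have := mul_nonneg hv.le (sub_nonneg.2 ht₁)
      linarith
  rw [bumpInterp]
  rcases le_total x (1 / 2) with hx | hx
  · rw [cutoff_eq_zero (t := (2 + a + b) * (1 - x)) (by nlinarith), mul_zero, add_zero, sub_zero]
    exact pos_of_mix ha hc (cutoff_nonneg _) (cutoff_le_one _)
  · rw [cutoff_eq_zero (t := (2 + a + b) * x) (by nlinarith), mul_zero, zero_add, sub_zero]
    exact pos_of_mix hb hc (cutoff_nonneg _) (cutoff_le_one _)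

/-- Reflecting `x` exchanges the two endpoint values. -/
theorem bumpInterp_one_sub (a b x : ℝ) : bumpInterp a b (1 - x) = bumpInterp b a x := by
  simp only [bumpInterp, bumpLevel, sub_sub_cancel, add_right_comm 2 a b, add_comm a b]
  ring

theorem bumpInterp_eq_left {a b x : ℝ} (ha : 0 < a) (hb : 0 < b)
    (hx : x < 1 / (2 * (2 + a + b))) : bumpInterp a b x = a := by
  rw [lt_div_iff₀ (by positivity)] at hx
  rw [bumpInterp, cutoff_eq_one (t := (2 + a + b) * x) (by linarith),
    cutoff_eq_zero (t := (2 + a + b) * (1 - x)) (by linarith)]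
  ring

theorem integral_bumpInterp {a b : ℝ} (ha : 0 < a) (hb : 0 < b) :
    ∫ x in (0 : ℝ)..1, bumpInterp a b x = 1 := by
  have hκ := cutoffMass_le_one
  have hM : 1 ≤ 2 + a + b := by linarith
  have hden : 2 + a + b - 2 * cutoffMass ≠ 0 := ne_of_gt (by linarith)
  have hcont := cutoff_contDiff.continuous
  have hleft : IntervalIntegrable (fun x => cutoff ((2 + a + b) * x))
      MeasureTheory.volume 0 1 := (hcont.comp (by fun_prop)).intervalIntegrable _ _
  have hright : IntervalIntegrable (fun x => cutoff ((2 + a + b) * (1 - x)))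
      MeasureTheory.volume 0 1 := (hcont.comp (by fun_prop)).intervalIntegrable _ _
  have hform : ∀ x, bumpInterp a b x = bumpLevel a b +
      (a - bumpLevel a b) * cutoff ((2 + a + b) * x) +
      (b - bumpLevel a b) * cutoff ((2 + a + b) * (1 - x)) := fun x => by
    rw [bumpInterp]
    ring
  simp only [hform]
  rw [intervalIntegral.integral_add (intervalIntegrable_const.add (hleft.const_mul _))
      (hright.const_mul _),
    intervalIntegral.integral_add intervalIntegrable_const (hleft.const_mul _),
    intervalIntegral.integral_const, intervalIntegral.integral_const_mul,
    intervalIntegral.integral_const_mul, integral_cutoff_mul hM, integral_cutoff_mul_one_sub hM,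
    sub_zero, one_smul]
  have hlevel : bumpLevel a b * (2 + a + b - 2 * cutoffMass) =
      2 + a + b - cutoffMass * (a + b) := div_mul_cancel₀ _ hden
  have hM₀ : 2 + a + b ≠ 0 := by linarith
  field_simp
  linear_combination hlevel

theorem bumpInterp_one_one (x : ℝ) : bumpInterp 1 1 x = 1 := by
  have hlevel : bumpLevel 1 1 = 1 := by
    have h := cutoffMass_le_one
    rw [bumpLevel, div_eq_one_iff_eq (ne_of_gt (by linarith))]
    ring
  rw [bumpInterp, hlevel]
  ring

/-- **Interpolation bump function.**  There is a smooth positive function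
`β : (0,∞) × (0,∞) × ℝ → (0,∞)` equal to `a` near `0` (and for `x ≤ 0`), equal to `b`
near `1` (and for `x ≥ 1`), with `β(1,1,·) ≡ 1` and `∫₀¹ β(a,b,x) dx = 1`. -/
theorem exists_interpolating_bump :
    ∃ β : ℝ → ℝ → ℝ → ℝ,
      ContDiffOn ℝ (⊤ : ℕ∞) (fun p : ℝ × ℝ × ℝ => β p.1 p.2.1 p.2.2)
        (Set.Ioi (0:ℝ) ×ˢ Set.Ioi (0:ℝ) ×ˢ (Set.univ : Set ℝ)) ∧
      (∀ a b x : ℝ, 0 < a → 0 < b → 0 < β a b x) ∧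
      (∀ a b : ℝ, 0 < a → 0 < b →
        (∃ δ > (0:ℝ), ∀ x : ℝ, x < δ → β a b x = a) ∧
        (∃ δ > (0:ℝ), ∀ x : ℝ, 1 - δ < x → β a b x = b) ∧
        ∫ x in (0:ℝ)..1, β a b x = 1) ∧
      (∀ x : ℝ, β 1 1 x = 1) := by
  refine ⟨bumpInterp, bumpInterp_contDiffOn, fun a b x ha hb => bumpInterp_pos ha hb x,
    fun a b ha hb => ⟨⟨1 / (2 * (2 + a + b)), by positivity,
      fun x hx => bumpInterp_eq_left ha hb hx⟩, ⟨1 / (2 * (2 + b + a)), by positivity,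
      fun x hx => ?_⟩, integral_bumpInterp ha hb⟩, bumpInterp_one_one⟩
  rw [← bumpInterp_one_sub]
  exact bumpInterp_eq_left hb ha (by linarith)
end

section
/- There exists a C^∞ function β : (0,∞) × (0,∞) × (0,∞) × ℝ → (0,∞) such that for all a, b, c > 0: (i) β(a, b, c, x) = a for all x in some neighborhood of 0, (ii) β(a, b, c, x) = b for all x in some neighborhood of 1, (iii) β(a, b, c, x) = c for all x in some neighborhood of −1, (iv) β(1, 1, 1, x) = 1 for all x ∈ ℝ, and (v) ∫_{−1}^{0} β(a, b, c, x) dx = 1 and ∫_{0}^{1} β(a, b, c, x) dx = 1. -/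
open Set

/-- A smooth even cutoff on the line, equal to `1` on `[-1, 1]` and to `0` off `(-2, 2)`. -/
structure IsEvenCutoff (φ : ℝ → ℝ) : Prop where
  contDiff : ContDiff ℝ (⊤ : ℕ∞) φ
  nonneg : ∀ x, 0 ≤ φ x
  le_one : ∀ x, φ x ≤ 1
  neg : ∀ x, φ (-x) = φ x
  eq_one : ∀ x, |x| ≤ 1 → φ x = 1
  eq_zero : ∀ x, 2 ≤ |x| → φ x = 0

theorem exists_isEvenCutoff : ∃ φ : ℝ → ℝ, IsEvenCutoff φ := by
  let f : ContDiffBump (0 : ℝ) := ⟨1, 2, one_pos, one_lt_two⟩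
  refine ⟨f, f.contDiff, fun x => f.nonneg, fun x => f.le_one, fun x => f.neg x,
    fun x hx => f.one_of_mem_closedBall ?_, fun x hx => f.zero_of_le_dist ?_⟩
  · simpa [f] using hx
  · simpa [f] using hx

namespace IsEvenCutoff

variable {φ : ℝ → ℝ}

theorem continuous (h : IsEvenCutoff φ) : Continuous φ := h.contDiff.continuous

theorem eq_zero_of_scale (h : IsEvenCutoff φ) {N y : ℝ} (hN : 8 ≤ N) (hy : 1 / 4 ≤ |y|) :
    φ (N * y) = 0 := by
  apply h.eq_zero
  rw [abs_mul, abs_of_pos (by linarith)]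
  nlinarith

theorem eq_one_of_scale (h : IsEvenCutoff φ) {N y : ℝ} (hN : 0 < N) (hy : |y| < 1 / N) :
    φ (N * y) = 1 := by
  apply h.eq_one
  rw [abs_mul, abs_of_pos hN]
  rw [lt_div_iff₀ hN] at hy
  linarith

theorem integral_zero_right (h : IsEvenCutoff φ) {T : ℝ} (hT : 2 ≤ T) :
    ∫ x in (0 : ℝ)..T, φ x = ∫ x in (0 : ℝ)..2, φ x := by
  rw [← intervalIntegral.integral_add_adjacent_intervals
    (h.continuous.intervalIntegrable 0 2) (h.continuous.intervalIntegrable 2 T)]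
  have h0 : ∫ x in (2 : ℝ)..T, φ x = ∫ _ in (2 : ℝ)..T, (0 : ℝ) := by
    apply intervalIntegral.integral_congr
    intro x hx
    rw [uIcc_of_le hT] at hx
    exact h.eq_zero x (hx.1.trans (le_abs_self x))
  rw [h0]
  simp

theorem integral_left_zero (h : IsEvenCutoff φ) {T : ℝ} (hT : 2 ≤ T) :
    ∫ x in (-T)..0, φ x = ∫ x in (0 : ℝ)..2, φ x := by
  rw [← h.integral_zero_right hT]
  have := intervalIntegral.integral_comp_neg (a := 0) (b := T) φ
  simp only [h.neg, neg_zero] at this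
  exact this.symm

theorem integral_scale (h : IsEvenCutoff φ) {N : ℝ} (hN : 8 ≤ N) :
    ∫ x in (0 : ℝ)..1, φ (N * x) = N⁻¹ * ∫ x in (0 : ℝ)..2, φ x := by
  rw [intervalIntegral.integral_comp_mul_left φ (by linarith : N ≠ 0), mul_zero, mul_one,
    h.integral_zero_right (by linarith), smul_eq_mul]

theorem integral_scale_sub_one (h : IsEvenCutoff φ) {N : ℝ} (hN : 8 ≤ N) :
    ∫ x in (0 : ℝ)..1, φ (N * (x - 1)) = N⁻¹ * ∫ x in (0 : ℝ)..2, φ x := by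
  rw [intervalIntegral.integral_comp_sub_right (fun x => φ (N * x)),
    intervalIntegral.integral_comp_mul_left φ (by linarith : N ≠ 0), smul_eq_mul,
    ← h.integral_left_zero (show 2 ≤ N by linarith)]
  norm_num

theorem integral_scale_sub_half (h : IsEvenCutoff φ) :
    ∫ x in (0 : ℝ)..1, φ (8 * (x - 1 / 2)) = (1 / 4) * ∫ x in (0 : ℝ)..2, φ x := by
  rw [intervalIntegral.integral_comp_sub_right (fun x => φ (8 * x)),
    intervalIntegral.integral_comp_mul_left φ (by norm_num : (8 : ℝ) ≠ 0), smul_eq_mul,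
    ← intervalIntegral.integral_add_adjacent_intervals
      (h.continuous.intervalIntegrable _ 0) (h.continuous.intervalIntegrable 0 _)]
  have h1 := h.integral_left_zero (T := 4) (by norm_num)
  have h2 := h.integral_zero_right (T := 4) (by norm_num)
  norm_num [h1, h2]
  ring

end IsEvenCutoff

/-- The constant `1`, modified to the values `a`, `b`, `c` near `0`, `1`, `-1` on a scale shrinking
with the size of the parameters, and corrected near `1 / 2` and `-1 / 2` to have mean one. -/
noncomputable def interpolatingBump (φ : ℝ → ℝ) (a b c x : ℝ) : ℝ :=
  1 + (a - 1) * φ (8 * (1 + a + b + c) * x) + (b - 1) * φ (8 * (1 + a + b + c) * (x - 1))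
    + (c - 1) * φ (8 * (1 + a + b + c) * (x + 1))
    - (a + b - 2) / (2 * (1 + a + b + c)) * φ (8 * (x - 1 / 2))
    - (a + c - 2) / (2 * (1 + a + b + c)) * φ (8 * (x + 1 / 2))

namespace IsEvenCutoff

variable {φ : ℝ → ℝ}

theorem interpolatingBump_neg (h : IsEvenCutoff φ) (a b c x : ℝ) :
    interpolatingBump φ a b c (-x) = interpolatingBump φ a c b x := by
  have h1 (N y : ℝ) : φ (N * (-x - y)) = φ (N * (x + y)) := by rw [← h.neg]; ring_nf
  have h2 (N y : ℝ) : φ (N * (-x + y)) = φ (N * (x - y)) := by rw [← h.neg]; ring_nf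
  have h3 (N : ℝ) : φ (N * -x) = φ (N * x) := by rw [← h.neg]; ring_nf
  simp only [interpolatingBump, h1, h2, h3, show 1 + a + c + b = 1 + a + b + c by ring]
  ring

theorem contDiffOn_interpolatingBump (h : IsEvenCutoff φ) :
    ContDiffOn ℝ (⊤ : ℕ∞)
      (fun p : ℝ × ℝ × ℝ × ℝ => interpolatingBump φ p.1 p.2.1 p.2.2.1 p.2.2.2)
      (Ioi (0 : ℝ) ×ˢ Ioi (0 : ℝ) ×ˢ Ioi (0 : ℝ) ×ˢ (univ : Set ℝ)) := by
  have hφ := h.contDiff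
  have hne : ∀ p ∈ Ioi (0 : ℝ) ×ˢ Ioi (0 : ℝ) ×ˢ Ioi (0 : ℝ) ×ˢ (univ : Set ℝ),
      2 * (1 + p.1 + p.2.1 + p.2.2.1) ≠ 0 := by
    rintro ⟨a, b, c, x⟩ ⟨ha, hb, hc, -⟩
    simp only [mem_Ioi] at ha hb hc
    dsimp only
    positivity
  unfold interpolatingBump
  refine ((ContDiff.contDiffOn (by fun_prop)).sub (ContDiffOn.mul (ContDiffOn.div
    (ContDiff.contDiffOn (by fun_prop)) (ContDiff.contDiffOn (by fun_prop)) hne)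
    (ContDiff.contDiffOn (by fun_prop)))).sub (ContDiffOn.mul (ContDiffOn.div
    (ContDiff.contDiffOn (by fun_prop)) (ContDiff.contDiffOn (by fun_prop)) hne)
    (ContDiff.contDiffOn (by fun_prop)))

variable {a b c x : ℝ}

theorem interpolatingBump_of_abs_lt (h : IsEvenCutoff φ) (ha : 0 < a) (hb : 0 < b) (hc : 0 < c)
    (hx : |x| < 1 / 4) :
    interpolatingBump φ a b c x = 1 + (a - 1) * φ (8 * (1 + a + b + c) * x) := by
  have hN : 8 ≤ 8 * (1 + a + b + c) := by linarith
  obtain ⟨h1, h2⟩ := abs_lt.1 hx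
  rw [interpolatingBump, h.eq_zero_of_scale hN (y := x - 1) (le_abs.2 (by right; linarith)),
    h.eq_zero_of_scale hN (y := x + 1) (le_abs.2 (by left; linarith)),
    h.eq_zero_of_scale le_rfl (y := x - 1 / 2) (le_abs.2 (by right; linarith)),
    h.eq_zero_of_scale le_rfl (y := x + 1 / 2) (le_abs.2 (by left; linarith))]
  ring

theorem interpolatingBump_of_abs_sub_one_lt (h : IsEvenCutoff φ) (ha : 0 < a) (hb : 0 < b)
    (hc : 0 < c) (hx : |x - 1| < 1 / 4) :
    interpolatingBump φ a b c x = 1 + (b - 1) * φ (8 * (1 + a + b + c) * (x - 1)) := by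
  have hN : 8 ≤ 8 * (1 + a + b + c) := by linarith
  obtain ⟨h1, h2⟩ := abs_lt.1 hx
  rw [interpolatingBump, h.eq_zero_of_scale hN (y := x) (le_abs.2 (by left; linarith)),
    h.eq_zero_of_scale hN (y := x + 1) (le_abs.2 (by left; linarith)),
    h.eq_zero_of_scale le_rfl (y := x - 1 / 2) (le_abs.2 (by left; linarith)),
    h.eq_zero_of_scale le_rfl (y := x + 1 / 2) (le_abs.2 (by left; linarith))]
  ring

theorem one_add_sub_one_mul_pos (h : IsEvenCutoff φ) (ha : 0 < a) (y : ℝ) :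
    0 < 1 + (a - 1) * φ y := by
  rcases (h.le_one y).eq_or_lt with h1 | h1
  · rw [h1]; linarith
  · nlinarith [mul_nonneg ha.le (h.nonneg y)]

theorem div_mul_lt_one (h : IsEvenCutoff φ) (ha : 0 < a) (hb : 0 < b) (hc : 0 < c) (y : ℝ) :
    (a + b - 2) / (2 * (1 + a + b + c)) * φ y < 1 := by
  have h1 : (a + b - 2) / (2 * (1 + a + b + c)) ≤ 1 / 2 := by
    rw [div_le_iff₀ (by positivity)]
    linarith
  linarith [mul_le_mul_of_nonneg_right h1 (h.nonneg y), h.le_one y]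

theorem interpolatingBump_pos_of_nonneg (h : IsEvenCutoff φ) (ha : 0 < a) (hb : 0 < b)
    (hc : 0 < c) (hx : 0 ≤ x) : 0 < interpolatingBump φ a b c x := by
  by_cases h0 : |x| < 1 / 4
  · rw [h.interpolatingBump_of_abs_lt ha hb hc h0]
    exact h.one_add_sub_one_mul_pos ha _
  by_cases h1 : |x - 1| < 1 / 4
  · rw [h.interpolatingBump_of_abs_sub_one_lt ha hb hc h1]
    exact h.one_add_sub_one_mul_pos hb _
  have hN : 8 ≤ 8 * (1 + a + b + c) := by linarith
  rw [interpolatingBump, h.eq_zero_of_scale hN (not_lt.1 h0),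
    h.eq_zero_of_scale hN (not_lt.1 h1),
    h.eq_zero_of_scale hN (y := x + 1) (le_abs.2 (by left; linarith)),
    h.eq_zero_of_scale le_rfl (y := x + 1 / 2) (le_abs.2 (by left; linarith))]
  linarith [h.div_mul_lt_one ha hb hc (8 * (x - 1 / 2))]

theorem interpolatingBump_pos (h : IsEvenCutoff φ) (ha : 0 < a) (hb : 0 < b) (hc : 0 < c) :
    0 < interpolatingBump φ a b c x := by
  rcases le_total 0 x with hx | hx
  · exact h.interpolatingBump_pos_of_nonneg ha hb hc hx
  · rw [← neg_neg x, h.interpolatingBump_neg]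
    exact h.interpolatingBump_pos_of_nonneg ha hc hb (by linarith)

theorem integral_interpolatingBump (h : IsEvenCutoff φ) (ha : 0 < a) (hb : 0 < b) (hc : 0 < c) :
    ∫ x in (0 : ℝ)..1, interpolatingBump φ a b c x = 1 := by
  have hN : 8 ≤ 8 * (1 + a + b + c) := by linarith
  have hcont := h.continuous
  have hcongr : ∫ x in (0 : ℝ)..1, interpolatingBump φ a b c x =
      ∫ x in (0 : ℝ)..1, (1 + (a - 1) * φ (8 * (1 + a + b + c) * x)
        + (b - 1) * φ (8 * (1 + a + b + c) * (x - 1))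
        - (a + b - 2) / (2 * (1 + a + b + c)) * φ (8 * (x - 1 / 2))) := by
    apply intervalIntegral.integral_congr
    intro x hx
    rw [uIcc_of_le zero_le_one] at hx
    have h0 := hx.1
    dsimp only
    rw [interpolatingBump, h.eq_zero_of_scale hN (y := x + 1) (le_abs.2 (by left; linarith)),
      h.eq_zero_of_scale le_rfl (y := x + 1 / 2) (le_abs.2 (by left; linarith))]
    ring
  rw [hcongr, intervalIntegral.integral_sub (Continuous.intervalIntegrable (by fun_prop) _ _)
      (Continuous.intervalIntegrable (by fun_prop) _ _),
    intervalIntegral.integral_add (Continuous.intervalIntegrable (by fun_prop) _ _)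
      (Continuous.intervalIntegrable (by fun_prop) _ _),
    intervalIntegral.integral_add (Continuous.intervalIntegrable (by fun_prop) _ _)
      (Continuous.intervalIntegrable (by fun_prop) _ _)]
  simp only [intervalIntegral.integral_const_mul]
  rw [h.integral_scale hN, h.integral_scale_sub_one hN, h.integral_scale_sub_half]
  have hpos : 1 + a + b + c ≠ 0 := by positivity
  simp only [intervalIntegral.integral_const, sub_zero, one_smul]
  field_simp
  ring

end IsEvenCutoff

/-- **Two-sided interpolation bump function.**  There is a smooth positive function
`β : (0,∞)³ × ℝ → (0,∞)` equal to `a` near `0`, to `b` near `1`, to `c` near `-1`, with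
`β(1,1,1,·) ≡ 1` and `∫_{-1}^{0} β(a,b,c,x) dx = ∫₀¹ β(a,b,c,x) dx = 1`. -/
theorem exists_interpolating_bump_two_sided :
    ∃ β : ℝ → ℝ → ℝ → ℝ → ℝ,
      ContDiffOn ℝ (⊤ : ℕ∞) (fun p : ℝ × ℝ × ℝ × ℝ => β p.1 p.2.1 p.2.2.1 p.2.2.2)
        (Set.Ioi (0:ℝ) ×ˢ Set.Ioi (0:ℝ) ×ˢ Set.Ioi (0:ℝ) ×ˢ (Set.univ : Set ℝ)) ∧
      (∀ a b c x : ℝ, 0 < a → 0 < b → 0 < c → 0 < β a b c x) ∧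
      (∀ a b c : ℝ, 0 < a → 0 < b → 0 < c →
        (∃ δ > (0:ℝ), ∀ x : ℝ, |x| < δ → β a b c x = a) ∧
        (∃ δ > (0:ℝ), ∀ x : ℝ, |x - 1| < δ → β a b c x = b) ∧
        (∃ δ > (0:ℝ), ∀ x : ℝ, |x + 1| < δ → β a b c x = c) ∧
        (∫ x in (-1:ℝ)..0, β a b c x = 1) ∧
        ∫ x in (0:ℝ)..1, β a b c x = 1) ∧
      (∀ x : ℝ, β 1 1 1 x = 1) := by
  obtain ⟨φ, h⟩ := exists_isEvenCutoff
  refine ⟨interpolatingBump φ, h.contDiffOn_interpolatingBump,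
    fun a b c x ha hb hc => h.interpolatingBump_pos ha hb hc, fun a b c ha hb hc => ?_,
    fun x => by simp [interpolatingBump]; norm_num⟩
  have hN : 0 < 8 * (1 + a + b + c) := by positivity
  have hδ : 1 / (8 * (1 + a + b + c)) < 1 / 4 :=
    one_div_lt_one_div_of_lt (by norm_num) (by linarith)
  have hone (a b c : ℝ) (ha : 0 < a) (hb : 0 < b) (hc : 0 < c) (x : ℝ)
      (hx : |x - 1| < 1 / (8 * (1 + a + b + c))) (hδ : 1 / (8 * (1 + a + b + c)) < 1 / 4) :
      interpolatingBump φ a b c x = b := by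
    rw [h.interpolatingBump_of_abs_sub_one_lt ha hb hc (hx.trans hδ),
      h.eq_one_of_scale (by positivity) hx]
    ring
  refine ⟨⟨_, one_div_pos.2 hN, fun x hx => ?_⟩,
    ⟨_, one_div_pos.2 hN, fun x hx => hone a b c ha hb hc x hx hδ⟩,
    ⟨_, one_div_pos.2 hN, fun x hx => ?_⟩, ?_, h.integral_interpolatingBump ha hb hc⟩
  · rw [h.interpolatingBump_of_abs_lt ha hb hc (hx.trans hδ), h.eq_one_of_scale hN hx]
    ring
  · have hcomm : 1 + a + c + b = 1 + a + b + c := by ring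
    rw [← neg_neg x, h.interpolatingBump_neg]
    apply hone a c b ha hc hb _ _ (by rwa [hcomm])
    rwa [hcomm, ← abs_neg, neg_sub, sub_neg_eq_add, add_comm]
  · have := intervalIntegral.integral_comp_neg (a := 0) (b := 1) (interpolatingBump φ a b c)
    simp only [h.interpolatingBump_neg, neg_zero] at this
    rw [← this]
    exact h.integral_interpolatingBump ha hc hb
end
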